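/- There exists n₀ such that the following holds for every integer n ≥ n₀: if n = a₁² + b₁² for some integers a₁, b₁ with |b₁| ≤ exp((log n)^{2/7}), then the number of pairs of integers (a, b) with a² + b² = n and |b| < n^{1/4}·(log n)^{1/14} is at most thirty six. -/

import Mathlib

open Real

open scoped ContDiff

open Polynomial in
theorem iteratedDeriv_polynomial_eval (p : ℝ[X]) (m : ℕ) :
    iteratedDeriv m (fun x => p.eval x) = fun x => (derivative^[m] p).eval x := by
  induction m generalizing p with
  | zero => simp
  | succ m ih =>
    rw [iteratedDeriv_succ', Function.iterate_succ_apply, ← ih]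
    congr 1
    ext x
    exact p.deriv

/-- A smooth function with `m + 1` zeros has a zero of its `m`-th derivative between them. -/
theorem exists_iteratedDeriv_eq_zero (m : ℕ) (f : ℝ → ℝ) (hf : ContDiff ℝ ∞ f) (z : ℕ → ℝ)
    (hz : ∀ i < m, z i < z (i + 1)) (h0 : ∀ i ≤ m, f (z i) = 0) :
    ∃ ξ ∈ Set.Icc (z 0) (z m), iteratedDeriv m f ξ = 0 := by
  induction m generalizing f z with
  | zero => exact ⟨z 0, by simp, by simpa using h0 0 le_rfl⟩
  | succ m ih =>
    have key : ∀ i, ∃ w, i ≤ m → w ∈ Set.Ioo (z i) (z (i + 1)) ∧ deriv f w = 0 := by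
      intro i
      by_cases hi : i ≤ m
      · obtain ⟨w, hw, hw'⟩ := exists_deriv_eq_zero (hz i (by omega)) hf.continuous.continuousOn
          ((h0 i (by omega)).trans (h0 (i + 1) (by omega)).symm)
        exact ⟨w, fun _ => ⟨hw, hw'⟩⟩
      · exact ⟨0, fun h => absurd h hi⟩
    choose w hw using key
    have hf' : ContDiff ℝ ∞ (deriv f) := by
      have : ContDiff ℝ (∞ + 1) f := by simpa using hf
      exact (contDiff_succ_iff_deriv.mp this).2.2
    obtain ⟨ξ, hξ, hξ'⟩ := ih (deriv f) hf' w
      (fun i hi => (hw i (by omega)).1.2.trans (hw (i + 1) (by omega)).1.1)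
      (fun i hi => (hw i hi).2)
    refine ⟨ξ, ⟨(hw 0 (by omega)).1.1.le.trans hξ.1, hξ.2.trans (hw m le_rfl).1.2.le⟩, ?_⟩
    rw [iteratedDeriv_succ', hξ']

theorem exists_iteratedDeriv_eq_zero_of_finset (m : ℕ) (f : ℝ → ℝ) (hf : ContDiff ℝ ∞ f)
    (s : Finset ℝ) (hs : s.card = m + 1) (h0 : ∀ x ∈ s, f x = 0) {a b : ℝ}
    (hab : ∀ x ∈ s, x ∈ Set.Icc a b) :
    ∃ ξ ∈ Set.Icc a b, iteratedDeriv m f ξ = 0 := by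
  let e := s.orderEmbOfFin hs
  let z : ℕ → ℝ := fun i => if h : i < m + 1 then e ⟨i, h⟩ else 0
  have hzs : ∀ i ≤ m, z i ∈ s := by
    intro i hi
    have : i < m + 1 := by omega
    simp only [z, this, dif_pos]
    exact s.orderEmbOfFin_mem hs _
  obtain ⟨ξ, hξ, hξ'⟩ := exists_iteratedDeriv_eq_zero m f hf z
    (by
      intro i hi
      have h1 : i < m + 1 := by omega
      have h2 : i + 1 < m + 1 := by omega
      simp only [z, h1, h2, dif_pos]
      exact e.strictMono (by simp [Fin.lt_def]))
    (fun i hi => h0 _ (hzs i hi))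
  exact ⟨ξ, ⟨(hab _ (hzs 0 (by omega))).1.trans hξ.1, hξ.2.trans (hab _ (hzs m le_rfl)).2⟩, hξ'⟩

open Polynomial in
/-- A smooth function which is small at well-spaced nodes is small between them, up to the
interpolation error. -/
theorem abs_le_of_small_on_nodes (f : ℝ → ℝ) (hf : ContDiff ℝ ∞ f) (s : Finset ℝ) {Z η C : ℝ}
    (hZ : 1 ≤ Z) (hsZ : ∀ x ∈ s, x ∈ Set.Icc 0 Z)
    (hsep : ∀ x ∈ s, ∀ y ∈ s, x ≠ y → 1 ≤ |x - y|) (hη : ∀ x ∈ s, |f x| ≤ η)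
    (hC : ∀ x ∈ Set.Icc 0 Z, |iteratedDeriv s.card f x| ≤ C) {z : ℝ} (hz : z ∈ Set.Icc 0 Z) :
    |f z| ≤ s.card * (η * Z ^ s.card) + C * Z ^ s.card / s.card.factorial := by
  have hC0 : 0 ≤ C := (abs_nonneg _).trans (hC z hz)
  have hZM : 1 ≤ Z ^ s.card := one_le_pow₀ hZ
  have hdiff : ∀ x ∈ Set.Icc 0 Z, ∀ y ∈ Set.Icc 0 Z, |x - y| ≤ Z := by
    intro x hx y hy
    rw [abs_le]; constructor <;> linarith [hx.1, hx.2, hy.1, hy.2]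
  by_cases hzs : z ∈ s
  · have h1 : (1 : ℝ) ≤ s.card := by exact_mod_cast Finset.card_pos.mpr ⟨z, hzs⟩
    have hη0 : 0 ≤ η := (abs_nonneg _).trans (hη z hzs)
    have h2 : η ≤ η * Z ^ s.card := le_mul_of_one_le_right hη0 hZM
    have h3 : η * Z ^ s.card ≤ s.card * (η * Z ^ s.card) :=
      le_mul_of_one_le_left (by positivity) h1
    have : 0 ≤ C * Z ^ s.card / s.card.factorial := by positivity
    linarith [hη z hzs]
  set P := Lagrange.interpolate s id f with hP
  have hinj : Set.InjOn (id : ℝ → ℝ) s := Function.injective_id.injOn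
  have hnod : (Lagrange.nodal s (id : ℝ → ℝ)).eval z ≠ 0 :=
    Lagrange.eval_nodal_not_at_node fun i hi h => hzs (by simpa [h] using hi)
  set c := (f z - P.eval z) / (Lagrange.nodal s (id : ℝ → ℝ)).eval z with hc
  set q : ℝ[X] := P + Polynomial.C c * Lagrange.nodal s id with hq
  have hqz : q.eval z = f z := by
    simp only [hq, eval_add, eval_mul, eval_C, hc]
    field_simp; ring
  have hqs : ∀ x ∈ s, q.eval x = f x := by
    intro x hx
    have h1 : P.eval x = f x := Lagrange.eval_interpolate_at_node (v := id) f hinj hx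
    have h2 : (Lagrange.nodal s (id : ℝ → ℝ)).eval x = 0 :=
      Lagrange.eval_nodal_at_node (v := id) hx
    simp [hq, h1, h2]
  have hPdeg : derivative^[s.card] P = 0 := by
    by_cases hP0 : P = 0
    · simp [hP0]
    · exact iterate_derivative_eq_zero
        ((natDegree_lt_iff_degree_lt hP0).mpr (Lagrange.degree_interpolate_lt _ hinj))
  have hNdeg : derivative^[s.card] (Lagrange.nodal s (id : ℝ → ℝ))
      = Polynomial.C (s.card.factorial : ℝ) := by
    have h1 : (derivative^[s.card] (Lagrange.nodal s (id : ℝ → ℝ))).natDegree = 0 := by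
      have := natDegree_iterate_derivative (Lagrange.nodal s (id : ℝ → ℝ)) s.card
      rw [Lagrange.natDegree_nodal] at this
      omega
    rw [eq_C_of_natDegree_eq_zero h1, coeff_iterate_derivative, zero_add, Nat.descFactorial_self]
    have h2 := (Lagrange.nodal_monic (s := s) (v := (id : ℝ → ℝ))).coeff_natDegree
    rw [Lagrange.natDegree_nodal] at h2
    simp [h2]
  have hqsm : ContDiff ℝ ∞ fun x => q.eval x := by simpa using q.contDiff_aeval (𝕜 := ℝ) ∞
  obtain ⟨ξ, hξ, hξ0⟩ := exists_iteratedDeriv_eq_zero_of_finset s.card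
    (f - fun x => q.eval x) (hf.sub hqsm) (insert z s) (by simp [hzs])
    (by
      intro x hx
      rcases Finset.mem_insert.mp hx with rfl | hx
      · simp [hqz]
      · simp [hqs x hx]) (a := 0) (b := Z)
    (by
      intro x hx
      rcases Finset.mem_insert.mp hx with rfl | hx
      · exact hz
      · exact hsZ x hx)
  rw [iteratedDeriv_sub (hf.contDiffAt.of_le (mod_cast le_top))
    (hqsm.contDiffAt.of_le (mod_cast le_top)), iteratedDeriv_polynomial_eval] at hξ0
  simp only [hq, iterate_map_add, iterate_derivative_C_mul, hPdeg, hNdeg] at hξ0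
  have hcf : iteratedDeriv s.card f ξ = c * s.card.factorial := by
    simpa [sub_eq_zero] using hξ0
  have hcb : |c| ≤ C / s.card.factorial := by
    have h1 := hC ξ hξ
    rw [hcf, abs_mul, Nat.abs_cast] at h1
    rwa [le_div_iff₀ (by positivity)]
  have hNz : |(Lagrange.nodal s (id : ℝ → ℝ)).eval z| ≤ Z ^ s.card := by
    rw [Lagrange.eval_nodal, Finset.abs_prod]
    calc ∏ i ∈ s, |z - id i| ≤ ∏ i ∈ s, Z :=
          Finset.prod_le_prod (fun _ _ => abs_nonneg _) fun i hi => hdiff _ hz _ (hsZ i hi)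
      _ = Z ^ s.card := by simp
  have hPz : |P.eval z| ≤ s.card * (η * Z ^ s.card) := by
    rw [hP, Lagrange.interpolate_apply, eval_finsetSum]
    refine (Finset.abs_sum_le_sum_abs _ _).trans ?_
    rw [← nsmul_eq_mul]
    refine Finset.sum_le_card_nsmul _ _ _ fun i hi => ?_
    rw [eval_mul, eval_C, abs_mul]
    have hη0 : 0 ≤ η := (abs_nonneg _).trans (hη i hi)
    refine mul_le_mul (hη i hi) ?_ (abs_nonneg _) hη0
    rw [Lagrange.basis, eval_prod, Finset.abs_prod]
    calc ∏ j ∈ s.erase i, |(Lagrange.basisDivisor (id i) (id j)).eval z|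
        ≤ ∏ j ∈ s.erase i, Z := by
          refine Finset.prod_le_prod (fun _ _ => abs_nonneg _) fun j hj => ?_
          have hj' := Finset.mem_erase.mp hj
          have h1 := hsep i hi j hj'.2 hj'.1.symm
          simp only [Lagrange.basisDivisor, eval_mul, eval_C, eval_sub, eval_X, id, abs_mul,
            abs_inv]
          have h2 := hdiff z hz j (hsZ j hj'.2)
          calc |i - j|⁻¹ * |z - j| ≤ 1 * Z :=
                mul_le_mul (inv_le_one_of_one_le₀ h1) h2 (abs_nonneg _) zero_le_one
            _ = Z := one_mul _
      _ = Z ^ (s.erase i).card := by simp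
      _ ≤ Z ^ s.card := pow_le_pow_right₀ hZ (Finset.card_le_card (Finset.erase_subset _ _))
  calc |f z| = |P.eval z + c * (Lagrange.nodal s (id : ℝ → ℝ)).eval z| := by
        rw [← hqz]; simp [hq]
    _ ≤ |P.eval z| + |c| * |(Lagrange.nodal s (id : ℝ → ℝ)).eval z| := by
        rw [← abs_mul]; exact abs_add_le _ _
    _ ≤ s.card * (η * Z ^ s.card) + C / s.card.factorial * Z ^ s.card := by
        gcongr
    _ = _ := by ring

/-- The derivatives of `x ^ k * exp (c * x)` on a bounded interval. -/
theorem abs_iteratedDeriv_pow_mul_exp_le (k m : ℕ) {c Z w x : ℝ} (hZ : 0 < Z) (hc : |c| ≤ w)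
    (hx : x ∈ Set.Icc 0 Z) :
    |iteratedDeriv m (fun x => x ^ k * Real.exp (c * x)) x|
      ≤ Z ^ k * Real.exp (w * Z) * (k / Z + w) ^ m := by
  have hw : 0 ≤ w := (abs_nonneg _).trans hc
  have h := iteratedDeriv_mul (n := m) (x := x) (f := fun x : ℝ => x ^ k)
    (g := fun x : ℝ => Real.exp (c * x)) (by fun_prop) (by fun_prop)
  have h' : iteratedDeriv m (fun x => x ^ k * Real.exp (c * x)) x = _ := h
  rw [h', add_pow, Finset.mul_sum]
  refine (Finset.abs_sum_le_sum_abs _ _).trans (Finset.sum_le_sum fun i hi => ?_)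
  rw [iteratedDeriv_pow, iteratedDeriv_exp_const_mul]
  simp only [abs_mul, Nat.abs_cast, abs_pow, Real.abs_exp]
  rw [abs_of_nonneg hx.1]
  have hexp : Real.exp (c * x) ≤ Real.exp (w * Z) := by
    refine Real.exp_le_exp.mpr ?_
    calc c * x ≤ |c| * x := mul_le_mul_of_nonneg_right (le_abs_self c) hx.1
      _ ≤ w * Z := mul_le_mul hc hx.2 hx.1 hw
  have hcw : |c| ^ (m - i) ≤ w ^ (m - i) := pow_le_pow_left₀ (abs_nonneg _) hc _
  have hd : (k.descFactorial i : ℝ) * x ^ (k - i) ≤ Z ^ k * (k / Z) ^ i := by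
    by_cases hik : i ≤ k
    · have h1 : (k.descFactorial i : ℝ) ≤ (k : ℝ) ^ i := by
        exact_mod_cast Nat.descFactorial_le_pow k i
      have h2 : x ^ (k - i) ≤ Z ^ (k - i) := pow_le_pow_left₀ hx.1 hx.2 _
      have h3 : Z ^ k * (k / Z) ^ i = (k : ℝ) ^ i * Z ^ (k - i) := by
        rw [div_pow, ← Nat.sub_add_cancel hik, pow_add, Nat.add_sub_cancel]
        field_simp
      rw [h3]
      exact mul_le_mul h1 h2 (pow_nonneg hx.1 _) (by positivity)
    · rw [Nat.descFactorial_eq_zero_iff_lt.mpr (by omega)]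
      simp only [Nat.cast_zero, zero_mul]
      positivity
  have hxk : 0 ≤ x ^ (k - i) := pow_nonneg hx.1 _
  calc (m.choose i : ℝ) * (k.descFactorial i * x ^ (k - i)) * (|c| ^ (m - i) * Real.exp (c * x))
      ≤ (m.choose i : ℝ) * (Z ^ k * (k / Z) ^ i) * (w ^ (m - i) * Real.exp (w * Z)) := by
        gcongr
    _ = _ := by ring

theorem int_eq_zero_of_sq_eq_mul_sq {D : ℕ} (hD : ¬ IsSquare D) {x y : ℤ}
    (h : x ^ 2 = D * y ^ 2) : x = 0 ∧ y = 0 := by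
  have hy : y = 0 := by
    by_contra hy
    have hirr := irrational_sqrt_natCast_iff.mpr hD
    refine hirr ⟨|(x : ℚ) / y|, ?_⟩
    have hy' : (y : ℝ) ≠ 0 := by exact_mod_cast hy
    have h' : (x : ℝ) ^ 2 = D * (y : ℝ) ^ 2 := by exact_mod_cast h
    push_cast
    rw [← Real.sqrt_sq_eq_abs, div_pow, h', mul_div_assoc, div_self (by positivity), mul_one]
  subst hy
  exact ⟨by simpa using h, rfl⟩

theorem int_add_mul_sqrt_eq_zero {D : ℕ} (hD : ¬ IsSquare D) {x y : ℤ}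
    (h : (x : ℝ) + y * √D = 0) : x = 0 ∧ y = 0 := by
  refine int_eq_zero_of_sq_eq_mul_sq hD ?_
  have h1 : (x : ℝ) ^ 2 = D * (y : ℝ) ^ 2 := by
    have h2 : (√D : ℝ) ^ 2 = D := Real.sq_sqrt (Nat.cast_nonneg _)
    rw [← h2, eq_neg_of_add_eq_zero_left h]; ring
  exact_mod_cast h1

theorem int_biquadratic_eq_zero {D₁ D₂ : ℕ} (h₁ : ¬ IsSquare D₁) (h₂ : ¬ IsSquare D₂)
    (h₁₂ : ¬ IsSquare (D₁ * D₂)) {a b c d : ℤ}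
    (h : (a : ℝ) + b * √D₁ + c * √D₂ + d * √D₁ * √D₂ = 0) :
    a = 0 ∧ b = 0 ∧ c = 0 ∧ d = 0 := by
  have s1 : (√D₁ : ℝ) ^ 2 = D₁ := Real.sq_sqrt (Nat.cast_nonneg _)
  have s2 : (√D₂ : ℝ) ^ 2 = D₂ := Real.sq_sqrt (Nat.cast_nonneg _)
  have key : ((a ^ 2 + D₁ * b ^ 2 - D₂ * (c ^ 2 + D₁ * d ^ 2) : ℤ) : ℝ)
      + ((2 * (a * b - D₂ * (c * d)) : ℤ) : ℝ) * √D₁ = 0 := by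
    push_cast
    linear_combination ((a : ℝ) + b * √D₁ - c * √D₂ - d * √D₁ * √D₂) * h
      + (- (b : ℝ) ^ 2 + d ^ 2 * (√D₂) ^ 2) * s1
      + ((c : ℝ) ^ 2 + 2 * c * d * √D₁ + d ^ 2 * D₁) * s2
  obtain ⟨e1, e2⟩ := int_add_mul_sqrt_eq_zero h₁ key
  have e2' : a * b = D₂ * (c * d) := by linarith
  have e3 : (a ^ 2 - D₂ * c ^ 2) * (a ^ 2 - (D₁ * D₂ : ℕ) * d ^ 2) = 0 := by
    push_cast
    linear_combination a ^ 2 * e1 - D₁ * (a * b + D₂ * (c * d)) * e2'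
  rcases mul_eq_zero.mp e3 with e | e
  · obtain ⟨ha, hc⟩ := int_eq_zero_of_sq_eq_mul_sq h₂ (sub_eq_zero.mp e)
    subst ha hc
    have hD1 : (D₁ : ℤ) ≠ 0 := by
      rintro h0
      exact h₁ (by rw [Nat.cast_eq_zero.mp h0]; exact ⟨0, rfl⟩)
    have : b ^ 2 = D₂ * d ^ 2 := by
      refine mul_left_cancel₀ hD1 ?_
      linear_combination e1
    obtain ⟨hb, hd⟩ := int_eq_zero_of_sq_eq_mul_sq h₂ this
    exact ⟨rfl, hb, rfl, hd⟩
  · obtain ⟨ha, hd⟩ := int_eq_zero_of_sq_eq_mul_sq h₁₂ (sub_eq_zero.mp e)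
    subst ha hd
    have : (D₁ * b) ^ 2 = (D₁ * D₂ : ℕ) * c ^ 2 := by
      push_cast
      linear_combination D₁ * e1
    obtain ⟨hb, hc⟩ := int_eq_zero_of_sq_eq_mul_sq h₁₂ this
    refine ⟨rfl, ?_, hc, rfl⟩
    rcases mul_eq_zero.mp hb with h0 | h0
    · exact absurd (by rw [Nat.cast_eq_zero.mp h0]; exact ⟨0, rfl⟩) h₁
    · exact h0

/-- The sign attached to a Boolean. -/
def boolSign (b : Bool) : ℝ := if b then 1 else -1

theorem boolSign_sq (b : Bool) : boolSign b ^ 2 = 1 := by cases b <;> norm_num [boolSign]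

theorem abs_boolSign (b : Bool) : |boolSign b| = 1 := by cases b <;> norm_num [boolSign]

/-- The order `ℤ[√D₁, √D₂]`, embedded through its four real embeddings. The embedding indexed by
`(true, true)` is the identity. -/
def biquadraticOrder (D₁ D₂ : ℕ) : Subring (Bool × Bool → ℝ) where
  carrier := {f | ∃ a b c d : ℤ, ∀ σ, f σ = a + b * (boolSign σ.1 * √D₁)
    + c * (boolSign σ.2 * √D₂) + d * (boolSign σ.1 * √D₁) * (boolSign σ.2 * √D₂)}
  zero_mem' := ⟨0, 0, 0, 0, by simp⟩
  one_mem' := ⟨1, 0, 0, 0, by simp⟩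
  add_mem' := by
    rintro f g ⟨a, b, c, d, h⟩ ⟨a', b', c', d', h'⟩
    refine ⟨a + a', b + b', c + c', d + d', fun σ => ?_⟩
    simp only [Pi.add_apply, h, h']; push_cast; ring
  neg_mem' := by
    rintro f ⟨a, b, c, d, h⟩
    refine ⟨-a, -b, -c, -d, fun σ => ?_⟩
    simp only [Pi.neg_apply, h]; push_cast; ring
  mul_mem' := by
    rintro f g ⟨a, b, c, d, h⟩ ⟨a', b', c', d', h'⟩
    refine ⟨a * a' + D₁ * b * b' + D₂ * c * c' + D₁ * D₂ * d * d',
      a * b' + b * a' + D₂ * (c * d' + d * c'), a * c' + c * a' + D₁ * (b * d' + d * b'),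
      a * d' + d * a' + b * c' + c * b', fun σ => ?_⟩
    have s1 : (boolSign σ.1 * √D₁) ^ 2 = D₁ := by
      rw [mul_pow, boolSign_sq, one_mul, Real.sq_sqrt (Nat.cast_nonneg _)]
    have s2 : (boolSign σ.2 * √D₂) ^ 2 = D₂ := by
      rw [mul_pow, boolSign_sq, one_mul, Real.sq_sqrt (Nat.cast_nonneg _)]
    simp only [Pi.mul_apply, h, h']
    push_cast
    generalize boolSign σ.1 * √D₁ = x at *
    generalize boolSign σ.2 * √D₂ = y at *
    rw [← s1, ← s2]
    ring

namespace biquadraticOrder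

variable {D₁ D₂ : ℕ} {f : Bool × Bool → ℝ}

theorem exists_int_prod_eq (hf : f ∈ biquadraticOrder D₁ D₂) : ∃ m : ℤ, ∏ σ, f σ = m := by
  obtain ⟨a, b, c, d, h⟩ := hf
  refine ⟨(a ^ 2 + D₁ * b ^ 2 - D₂ * (c ^ 2 + D₁ * d ^ 2)) ^ 2
    - D₁ * (2 * (a * b - D₂ * (c * d))) ^ 2, ?_⟩
  have s1 : (√D₁ : ℝ) ^ 2 = D₁ := Real.sq_sqrt (Nat.cast_nonneg _)
  have s2 : (√D₂ : ℝ) ^ 2 = D₂ := Real.sq_sqrt (Nat.cast_nonneg _)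
  rw [Fintype.prod_prod_type]
  simp only [Fintype.prod_bool, h, boolSign]
  push_cast
  generalize (√D₁ : ℝ) = x at *
  generalize (√D₂ : ℝ) = y at *
  rw [← s1, ← s2]
  norm_num
  ring

theorem eq_zero_of_apply_eq_zero (h₁ : ¬ IsSquare D₁) (h₂ : ¬ IsSquare D₂)
    (h₁₂ : ¬ IsSquare (D₁ * D₂)) (hf : f ∈ biquadraticOrder D₁ D₂) {σ : Bool × Bool}
    (h0 : f σ = 0) : f = 0 := by
  obtain ⟨a, b, c, d, h⟩ := hf
  have hs : ∀ b : Bool, ∃ s : ℤ, (s : ℝ) = boolSign b ∧ s ≠ 0 := by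
    rintro (_ | _)
    · exact ⟨-1, by simp [boolSign], by simp⟩
    · exact ⟨1, by simp [boolSign], by simp⟩
  obtain ⟨s, hs1, hs0⟩ := hs σ.1
  obtain ⟨t, ht, ht0⟩ := hs σ.2
  rw [h, ← hs1, ← ht] at h0
  obtain ⟨ha, hb, hc, hd⟩ := int_biquadratic_eq_zero (a := a) (b := b * s) (c := c * t)
    (d := d * s * t) h₁ h₂ h₁₂ (by push_cast; linarith)
  have hb' : b = 0 := by simpa [hs0] using hb
  have hc' : c = 0 := by simpa [ht0] using hc
  have hd' : d = 0 := by simpa [hs0, ht0] using hd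
  ext τ
  simp [h, ha, hb', hc', hd']

/-- Liouville's inequality. -/
theorem apply_eq_zero_of_small (h₁ : ¬ IsSquare D₁) (h₂ : ¬ IsSquare D₂)
    (h₁₂ : ¬ IsSquare (D₁ * D₂)) (hf : f ∈ biquadraticOrder D₁ D₂) {H : ℝ}
    (hH : ∀ σ, |f σ| ≤ H) (hsmall : |f (true, true)| * H ^ 3 < 1) : f (true, true) = 0 := by
  by_contra h0
  have hne : ∀ σ, f σ ≠ 0 := fun σ hσ => h0 (by
    rw [eq_zero_of_apply_eq_zero h₁ h₂ h₁₂ hf hσ]; rfl)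
  obtain ⟨m, hm⟩ := exists_int_prod_eq hf
  have hm0 : m ≠ 0 := by
    rintro rfl
    exact Finset.prod_ne_zero_iff.mpr (fun σ _ => hne σ) (by simpa using hm)
  have hm1 : (1 : ℝ) ≤ |(m : ℝ)| := by exact_mod_cast Int.one_le_abs hm0
  rw [← hm, Fintype.prod_prod_type] at hm1
  simp only [Fintype.prod_bool, abs_mul] at hm1
  have hH0 : 0 ≤ H := (abs_nonneg _).trans (hH (true, true))
  have : |f (true, true)| * |f (true, false)| * (|f (false, true)| * |f (false, false)|)
      ≤ |f (true, true)| * H * (H * H) := by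
    gcongr <;> exact hH _
  nlinarith

/-- The coordinates of an element are bounded by the size of its conjugates. -/
theorem exists_coord (hD₁ : 1 ≤ D₁) (hD₂ : 1 ≤ D₂) (hf : f ∈ biquadraticOrder D₁ D₂) {H : ℝ}
    (hH : ∀ σ, |f σ| ≤ H) : ∃ c : Fin 4 → ℤ, (∀ i, (|c i| : ℝ) ≤ H) ∧
      f (true, true) = c 0 + c 1 * √D₁ + c 2 * √D₂ + c 3 * √D₁ * √D₂ := by
  obtain ⟨a, b, c, d, h⟩ := hf
  refine ⟨![a, b, c, d], ?_, by rw [h]; simp [boolSign]⟩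
  have r1 : 1 ≤ √(D₁ : ℝ) := Real.one_le_sqrt.mpr (by exact_mod_cast hD₁)
  have r2 : 1 ≤ √(D₂ : ℝ) := Real.one_le_sqrt.mpr (by exact_mod_cast hD₂)
  have h12 : 1 ≤ √(D₁ : ℝ) * √(D₂ : ℝ) := one_le_mul_of_one_le_of_one_le r1 r2
  have htt := abs_le.mp (hH (true, true))
  have htf := abs_le.mp (hH (true, false))
  have hft := abs_le.mp (hH (false, true))
  have hff := abs_le.mp (hH (false, false))
  simp only [h, boolSign] at htt htf hft hff
  norm_num at htt htf hft hff
  have key : ∀ (z : ℤ) (r : ℝ), 1 ≤ r → |z * r| ≤ H → (|z| : ℝ) ≤ H := by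
    intro z r hr hz
    refine le_trans ?_ hz
    rw [abs_mul, abs_of_nonneg (zero_le_one.trans hr)]
    exact le_mul_of_one_le_right (abs_nonneg _) hr
  intro i
  fin_cases i
  · refine key a 1 le_rfl (abs_le.mpr ⟨?_, ?_⟩) <;> linarith
  · refine key b _ r1 (abs_le.mpr ⟨?_, ?_⟩) <;> linarith
  · refine key c _ r2 (abs_le.mpr ⟨?_, ?_⟩) <;> linarith
  · refine key d _ h12 (abs_le.mpr ⟨?_, ?_⟩) <;> linarith

end biquadraticOrder

open Polynomial in
theorem natDegree_det_le_of_forall {m d : ℕ} (M : Matrix (Fin m) (Fin m) ℝ[X])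
    (h : ∀ i j, (M i j).natDegree ≤ d) : M.det.natDegree ≤ m * d := by
  rw [Matrix.det_apply]
  refine natDegree_sum_le_of_forall_le _ _ fun σ _ => ?_
  refine (natDegree_smul_le _ _).trans ((natDegree_prod_le _ _).trans ?_)
  calc ∑ i, (M (σ i) i).natDegree ≤ ∑ _i : Fin m, d := Finset.sum_le_sum fun i _ => h _ _
    _ = m * d := by simp

open Polynomial Filter in
/-- Zero estimate: a polynomial `∑ Q l (X) * Y ^ l` cannot vanish at too many points
`(x + j, v ^ j * y)`. -/
theorem eq_zero_of_vanishing_on_translates {ℓ d : ℕ} (Q : Fin ℓ → ℝ[X]) {v : ℝ} (hv0 : 0 < v)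
    (hv1 : v ≠ 1) (hd : ∀ l, (Q l).natDegree ≤ d) (s : Finset ℝ) (hs : ℓ * d < s.card)
    (hvan : ∀ x ∈ s, ∃ y : ℝ, y ≠ 0 ∧
      ∀ j < ℓ, ∑ l, (Q l).eval (x + j) * (v ^ j * y) ^ (l : ℕ) = 0) (l : Fin ℓ) : Q l = 0 := by
  classical
  by_contra hl
  set T : Finset (Fin ℓ) := Finset.univ.filter fun l => Q l ≠ 0 with hT
  have hlT : l ∈ T := by simp [hT, hl]
  set m := T.card with hm
  have hmpos : 0 < m := Finset.card_pos.mpr ⟨l, hlT⟩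
  have hmℓ : m ≤ ℓ := by simpa using Finset.card_le_univ T
  let e : Fin m ≃ T := T.equivFin.symm
  have he : ∀ i, Q (e i) ≠ 0 := fun i => (Finset.mem_filter.mp (e i).2).2
  let u : Fin m → ℝ := fun i => v ^ ((e i : Fin ℓ) : ℕ)
  have hu : Function.Injective u := by
    intro i j hij
    have := pow_right_injective₀ hv0 hv1 hij
    exact e.injective (Subtype.ext (Fin.ext this))
  let M : Matrix (Fin m) (Fin m) ℝ[X] := Matrix.of fun j i =>
    Polynomial.C (u i ^ (j : ℕ)) * (Q (e i)).comp (X + Polynomial.C ((j : ℕ) : ℝ))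
  have hMeval : ∀ x, (M.det).eval x
      = (Matrix.of fun j i : Fin m => u i ^ (j : ℕ) * (Q (e i)).eval (x + (j : ℕ))).det := by
    intro x
    rw [← coe_evalRingHom, RingHom.map_det]
    congr 1
    ext j i
    simp [M]
  have hMdeg : M.det.natDegree ≤ ℓ * d := by
    refine (natDegree_det_le_of_forall M (d := d) fun j i => ?_).trans
      (Nat.mul_le_mul_right d hmℓ)
    simp only [M, Matrix.of_apply]
    refine (natDegree_C_mul_le _ _).trans ?_
    rw [natDegree_comp, natDegree_X_add_C, mul_one]
    exact hd _
  have hM0 : M.det = 0 := by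
    refine eq_zero_of_natDegree_lt_card_of_eval_eq_zero' M.det s (fun x hx => ?_)
      (hMdeg.trans_lt hs)
    obtain ⟨y, hy, hvy⟩ := hvan x hx
    rw [hMeval, ← Matrix.exists_mulVec_eq_zero_iff]
    refine ⟨fun i => y ^ ((e i : Fin ℓ) : ℕ), fun h => ?_, ?_⟩
    · exact pow_ne_zero _ hy (congrFun h ⟨0, hmpos⟩)
    · ext j
      rw [Pi.zero_apply, ← hvy j (j.2.trans_le hmℓ)]
      simp only [Matrix.mulVec, dotProduct, Matrix.of_apply]
      rw [← Finset.sum_subset (Finset.subset_univ T)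
        (fun l _ hl => by
          have : Q l = 0 := by simpa [hT] using hl
          simp [this]), ← Finset.sum_coe_sort T, ← Equiv.sum_comp e]
      refine Finset.sum_congr rfl fun i _ => ?_
      simp only [u]
      ring
  have hlim : Tendsto (fun x : ℝ => (Matrix.of fun j i : Fin m =>
      u i ^ (j : ℕ) * ((Q (e i)).eval (x + (j : ℕ)) / (Q (e i)).eval x)).det) atTop
      (nhds ((Matrix.vandermonde u).transpose.det)) := by
    have hc : Continuous fun A : Matrix (Fin m) (Fin m) ℝ => A.det := by fun_prop
    refine (hc.tendsto _).comp ?_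
    refine tendsto_pi_nhds.mpr fun j => tendsto_pi_nhds.mpr fun i => ?_
    have hdeg : ((Q (e i)).comp (X + Polynomial.C ((j : ℕ) : ℝ))).degree = (Q (e i)).degree := by
      rw [degree_comp (by rw [degree_X_add_C]; exact zero_lt_one), degree_X_add_C, mul_one]
    have h1 := div_tendsto_atTop_leadingCoeff_div_of_degree_eq _ _ hdeg
    rw [leadingCoeff_comp (by rw [natDegree_X_add_C]; exact one_ne_zero)] at h1
    simp only [leadingCoeff_X_add_C, one_pow, mul_one] at h1
    rw [div_self (leadingCoeff_ne_zero.mpr (he i))] at h1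
    have h2 := h1.const_mul (u i ^ (j : ℕ))
    simpa [Matrix.vandermonde] using h2
  have hzero : ∀ x : ℝ, (Matrix.of fun j i : Fin m =>
      u i ^ (j : ℕ) * ((Q (e i)).eval (x + (j : ℕ)) / (Q (e i)).eval x)).det = 0 := by
    intro x
    have h1 := Matrix.det_mul_row (fun i => ((Q (e i)).eval x)⁻¹)
      (Matrix.of fun j i : Fin m => u i ^ (j : ℕ) * (Q (e i)).eval (x + (j : ℕ)))
    rw [← hMeval, hM0, eval_zero, mul_zero] at h1
    rw [← h1]
    congr 1
    ext j i
    simp only [Matrix.of_apply]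
    ring
  have h0 := tendsto_nhds_unique hlim (by simp only [hzero]; exact tendsto_const_nhds)
  rw [Matrix.det_transpose] at h0
  exact Matrix.det_vandermonde_ne_zero_iff.mpr hu h0

/-- Siegel's lemma for systems of linear equations over `ℤ[√D₁, √D₂]`. -/
theorem biquadraticOrder.exists_int_relation {D₁ D₂ : ℕ} (hD₁ : 1 ≤ D₁) (hD₂ : 1 ≤ D₂)
    {X ι : Type*} [Fintype X] [Fintype ι] (hX : 0 < Fintype.card X)
    (hι : Fintype.card ι = 8 * Fintype.card X) (g : X → ι → Bool × Bool → ℝ)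
    (hg : ∀ x i, g x i ∈ biquadraticOrder D₁ D₂) {H : ℝ} (hH1 : 1 ≤ H)
    (hH : ∀ x i σ, |g x i σ| ≤ H) :
    ∃ p : ι → ℤ, p ≠ 0 ∧ (∀ i, (|p i| : ℝ) ≤ Fintype.card ι * H) ∧
      ∀ x, ∑ i, p i * g x i (true, true) = 0 := by
  choose c hc1 hc2 using fun x i => exists_coord hD₁ hD₂ (hg x i) (hH x i)
  let _ : SeminormedAddCommGroup (Matrix (X × Fin 4) ι ℤ) := Matrix.seminormedAddCommGroup
  let A : Matrix (X × Fin 4) ι ℤ := Matrix.of fun x i => c x.1 i x.2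
  have hcard : Fintype.card (X × Fin 4) = 4 * Fintype.card X := by
    rw [Fintype.card_prod, Fintype.card_fin, mul_comm]
  obtain ⟨p, hp0, hpA, hp⟩ := Int.Matrix.exists_ne_zero_int_vec_norm_le A (by omega) (by omega)
  have hA : ‖A‖ ≤ H := by
    refine (Matrix.norm_le_iff (by linarith)).mpr fun x i => ?_
    rw [Int.norm_eq_abs]
    exact hc1 _ _ _
  have hexp : ((Fintype.card (X × Fin 4) : ℕ) : ℝ)
      / ((Fintype.card ι : ℝ) - (Fintype.card (X × Fin 4) : ℕ)) = 1 := by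
    rw [hcard, hι]
    have : (0 : ℝ) < Fintype.card X := by exact_mod_cast hX
    push_cast
    rw [div_eq_one_iff_eq (by linarith)]
    ring
  rw [hexp, Real.rpow_one] at hp
  refine ⟨p, hp0, fun i => ?_, fun x => ?_⟩
  · rw [← Int.norm_eq_abs]
    refine (norm_le_pi_norm p i).trans (hp.trans ?_)
    gcongr
    exact max_le hH1 hA
  · have h : ∀ k, ∑ i, (p i : ℝ) * c x i k = 0 := by
      intro k
      have := congrFun hpA (x, k)
      simp only [Matrix.mulVec, dotProduct, A, Matrix.of_apply, Pi.zero_apply] at this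
      have h' : ∑ i, (c x i k : ℝ) * p i = 0 := by exact_mod_cast this
      simpa only [mul_comm] using h'
    calc ∑ i, p i * g x i (true, true)
        = ∑ i, (p i : ℝ) * c x i 0 + (∑ i, (p i : ℝ) * c x i 1) * √D₁
          + (∑ i, (p i : ℝ) * c x i 2) * √D₂ + (∑ i, (p i : ℝ) * c x i 3) * √D₁ * √D₂ := by
          simp only [Finset.sum_mul, ← Finset.sum_add_distrib]
          refine Finset.sum_congr rfl fun i _ => ?_
          rw [hc2]; ring
      _ = 0 := by simp [h]

/-- Bound for the derivatives of an exponential polynomial. -/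
theorem abs_iteratedDeriv_expPoly_le {K ℓ : ℕ} (p : Fin K × Fin ℓ → ℝ) {P c Z w x : ℝ} (m : ℕ)
    (hp : ∀ i, |p i| ≤ P) (hZ : 1 ≤ Z) (hw : ℓ * |c| ≤ w) (hx : x ∈ Set.Icc 0 Z) :
    |iteratedDeriv m (fun x => ∑ i, p i * (x ^ (i.1 : ℕ) * exp (i.2 * c * x))) x|
      ≤ K * ℓ * (P * (Z ^ K * exp (w * Z) * (K / Z + w) ^ m)) := by
  have hw0 : 0 ≤ w := le_trans (by positivity) hw
  have hP0 : ∀ i : Fin K × Fin ℓ, 0 ≤ P := fun i => (abs_nonneg _).trans (hp i)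
  have hsm : ∀ i : Fin K × Fin ℓ,
      ContDiff ℝ m fun x : ℝ => x ^ (i.1 : ℕ) * exp (i.2 * c * x) := fun i => by fun_prop
  have hsum : iteratedDeriv m (fun x => ∑ i, p i * (x ^ (i.1 : ℕ) * exp (i.2 * c * x))) x
      = ∑ i : Fin K × Fin ℓ,
        p i * iteratedDeriv m (fun x => x ^ (i.1 : ℕ) * exp (i.2 * c * x)) x := by
    rw [iteratedDeriv_fun_sum fun i _ => (contDiff_const.mul (hsm i)).contDiffAt]
    refine Finset.sum_congr rfl fun i _ => ?_
    rw [iteratedDeriv_const_mul _ (hsm i).contDiffAt]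
  rw [hsum]
  refine (Finset.abs_sum_le_sum_abs _ _).trans ?_
  have hterm : ∀ i : Fin K × Fin ℓ,
      |p i * iteratedDeriv m (fun x => x ^ (i.1 : ℕ) * exp (i.2 * c * x)) x|
        ≤ P * (Z ^ K * exp (w * Z) * (K / Z + w) ^ m) := by
    intro i
    rw [abs_mul]
    refine mul_le_mul (hp i) ?_ (abs_nonneg _) (hP0 i)
    refine (abs_iteratedDeriv_pow_mul_exp_le (i.1 : ℕ) m (w := w) (by linarith) ?_ hx).trans ?_
    · rw [abs_mul, Nat.abs_cast]
      refine le_trans ?_ hw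
      gcongr
      exact i.2.2.le
    · have : (i.1 : ℕ) ≤ K := i.1.2.le
      gcongr
  refine (Finset.sum_le_sum fun i _ => hterm i).trans_eq ?_
  simp [mul_assoc]

theorem abs_exp_sub_exp_le {x y b : ℝ} (hx : x ≤ b) (hy : y ≤ b) :
    |exp x - exp y| ≤ |x - y| * exp b := by
  have key : ∀ {x y : ℝ}, x ≤ b → y ≤ x → |exp x - exp y| ≤ |x - y| * exp b := by
    intro x y hx hyx
    rw [abs_of_nonneg (sub_nonneg.mpr (exp_le_exp.mpr hyx)), abs_of_nonneg (sub_nonneg.mpr hyx)]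
    have h1 := add_one_le_exp (y - x)
    have h2 : exp y = exp x * exp (y - x) := by rw [← exp_add]; congr 1; ring
    have h3 := exp_pos x
    calc exp x - exp y ≤ (x - y) * exp x := by rw [h2]; nlinarith
      _ ≤ (x - y) * exp b :=
        mul_le_mul_of_nonneg_left (exp_le_exp.mpr hx) (sub_nonneg.mpr hyx)
  rcases le_total y x with h | h
  · exact key hx h
  · rw [abs_sub_comm, abs_sub_comm x]; exact key hy h

/-- The monomial `(r + b s) ^ k α ^ (l r) ν ^ (l s) δ ^ (L - l s)`. -/
def interpolationTerm (α ν : Bool × Bool → ℝ) (δ b L k l r s : ℕ) : Bool × Bool → ℝ :=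
  ((r + b * s : ℕ) : Bool × Bool → ℝ) ^ k * α ^ (l * r) * ν ^ (l * s)
    * (δ : Bool × Bool → ℝ) ^ (L - l * s)

section interpolationTerm

variable {D₁ D₂ : ℕ} {α ν : Bool × Bool → ℝ} {δ b L k l r s : ℕ}

theorem interpolationTerm_mem (hα : α ∈ biquadraticOrder D₁ D₂)
    (hν : ν ∈ biquadraticOrder D₁ D₂) :
    interpolationTerm α ν δ b L k l r s ∈ biquadraticOrder D₁ D₂ :=
  mul_mem (mul_mem (mul_mem (pow_mem (natCast_mem _ _) _) (pow_mem hα _)) (pow_mem hν _))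
    (pow_mem (natCast_mem _ _) _)

theorem abs_interpolationTerm_le {A G x y z : ℝ}
    (hδ : (δ : ℝ) ≤ exp G) (hα : ∀ σ, |α σ| ≤ exp A) (hν : ∀ σ, |ν σ| ≤ exp G)
    (hls : l * s ≤ L) (hx : ((r + b * s : ℕ) : ℝ) ^ k ≤ exp x) (hy : A * (l * r) ≤ y)
    (hz : G * L ≤ z) (σ : Bool × Bool) :
    |interpolationTerm α ν δ b L k l r s σ| ≤ exp (x + y + z) := by
  have h1 : |α σ| ^ (l * r) ≤ exp y := by
    refine (pow_le_pow_left₀ (abs_nonneg _) (hα σ) _).trans ?_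
    rw [← exp_nat_mul]
    refine exp_le_exp.mpr (le_trans (le_of_eq ?_) hy)
    push_cast; ring
  have h2 : |ν σ| ^ (l * s) * (δ : ℝ) ^ (L - l * s) ≤ exp z := by
    calc |ν σ| ^ (l * s) * (δ : ℝ) ^ (L - l * s)
        ≤ exp G ^ (l * s) * exp G ^ (L - l * s) := by
          gcongr
          exact hν σ
      _ = exp (L * G) := by rw [← pow_add, Nat.add_sub_cancel' hls, exp_nat_mul]
      _ ≤ exp z := exp_le_exp.mpr (by linarith)
  have h3 : |interpolationTerm α ν δ b L k l r s σ| = ((r + b * s : ℕ) : ℝ) ^ k *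
      |α σ| ^ (l * r) * (|ν σ| ^ (l * s) * (δ : ℝ) ^ (L - l * s)) := by
    simp only [interpolationTerm, Pi.mul_apply, Pi.pow_apply, Pi.natCast_apply, abs_mul, abs_pow,
      Nat.abs_cast]
    ring
  rw [h3, exp_add, exp_add]
  gcongr

theorem interpolationTerm_apply_div (hδ : 1 ≤ δ) (hα : 0 < α (true, true))
    (hν : 0 < ν (true, true)) (hls : l * s ≤ L) :
    interpolationTerm α ν δ b L k l r s (true, true) / (δ : ℝ) ^ L
      = ((r + b * s : ℕ) : ℝ) ^ k
        * exp (l * r * log (α (true, true)) + l * s * log (ν (true, true) / δ)) := by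
  have hδ0 : (0 : ℝ) < δ := by exact_mod_cast hδ
  have h1 : exp (l * r * log (α (true, true))) = α (true, true) ^ (l * r) := by
    rw [← Nat.cast_mul, exp_nat_mul, exp_log hα]
  have h2 : exp (l * s * log (ν (true, true) / δ)) = (ν (true, true) / δ) ^ (l * s) := by
    rw [← Nat.cast_mul, exp_nat_mul, exp_log (by positivity)]
  rw [exp_add, h1, h2, div_eq_iff (by positivity)]
  simp only [interpolationTerm, Pi.mul_apply, Pi.pow_apply, Pi.natCast_apply]
  nth_rewrite 2 [← Nat.add_sub_cancel' hls]
  rw [pow_add, div_pow]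
  field_simp

theorem abs_interpolationTerm_apply_div_sub_le (hδ : 1 ≤ δ) (hα : 0 < α (true, true))
    (hν : 0 < ν (true, true)) (hls : l * s ≤ L) {x y e : ℝ}
    (hx : ((r + b * s : ℕ) : ℝ) ^ k ≤ exp x)
    (he : |b * log (α (true, true)) - log (ν (true, true) / δ)| ≤ e) (hle : L * e ≤ 1)
    (hy : l * |log (α (true, true))| * (r + b * s : ℕ) ≤ y) :
    |interpolationTerm α ν δ b L k l r s (true, true) / (δ : ℝ) ^ L
      - ((r + b * s : ℕ) : ℝ) ^ k * exp (l * log (α (true, true)) * (r + b * s : ℕ))|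
      ≤ exp x * (L * e * exp (y + 1)) := by
  rw [interpolationTerm_apply_div hδ hα hν hls, ← mul_sub, abs_mul,
    abs_of_nonneg (by positivity : (0 : ℝ) ≤ ((r + b * s : ℕ) : ℝ) ^ k)]
  refine mul_le_mul hx ?_ (abs_nonneg _) (exp_nonneg _)
  set c := log (α (true, true))
  set u := log (ν (true, true) / δ)
  have hls' : (l : ℝ) * s ≤ L := by exact_mod_cast hls
  have h1 : |(l * r * c + l * s * u) - l * c * (r + b * s : ℕ)| ≤ L * e := by
    have : (l * r * c + l * s * u) - l * c * (r + b * s : ℕ) = -(l * s * (b * c - u)) := by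
      push_cast; ring
    rw [this, abs_neg, abs_mul, abs_of_nonneg (by positivity)]
    exact mul_le_mul hls' he (abs_nonneg _) (by positivity)
  have h2 : l * c * (r + b * s : ℕ) ≤ y := by
    refine le_trans ?_ hy
    gcongr
    exact le_abs_self c
  have h3 := (abs_le.mp h1).2
  refine (abs_exp_sub_exp_le (b := y + 1) (by linarith) (by linarith)).trans ?_
  gcongr

end interpolationTerm

theorem pow_self_div_factorial_le {M : ℕ} {y : ℝ} (hy : 0 ≤ y) (h : 200 * y ≤ M) :
    y ^ M / M.factorial ≤ exp (-4 * M) := by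
  have h1 : y ^ M ≤ (exp (-5) * M) ^ M := by
    refine pow_le_pow_left₀ hy ?_ _
    have h5 : exp 5 ≤ 200 := by
      have h1 := exp_one_lt_d9.le
      have : exp 5 = exp 1 ^ 5 := by rw [← exp_nat_mul]; norm_num
      rw [this]
      calc exp 1 ^ 5 ≤ (2.7182818286 : ℝ) ^ 5 := by gcongr
        _ ≤ 200 := by norm_num
    rw [exp_neg, inv_mul_eq_div, le_div_iff₀ (exp_pos _)]
    nlinarith
  have h2 := pow_div_factorial_le_exp (M : ℝ) (Nat.cast_nonneg M) M
  calc y ^ M / M.factorial ≤ (exp (-5) * M) ^ M / M.factorial := by gcongr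
    _ = exp (-5) ^ M * ((M : ℝ) ^ M / M.factorial) := by rw [mul_pow]; ring
    _ ≤ exp (-5) ^ M * exp M := by gcongr
    _ = exp (-4 * M) := by rw [← exp_nat_mul, ← exp_add]; congr 1; ring

/-- An exponential polynomial that is tiny at many integer points is small. -/
theorem abs_expPoly_le {K t X : ℕ} (p : Fin K × Fin t → ℤ) {c Z T : ℝ} (ht : 10000 ≤ t)
    (hX : 1 ≤ X) (hKt : K * t = 8000 * X) (hp : ∀ i, (|p i| : ℝ) ≤ exp (17 * X)) (hZ : 1 ≤ Z)
    (hZt : 1000 * log Z ≤ t) (hc : t * |c| * Z ≤ 4 * X) (hX8 : (8000 * X : ℝ) ≤ exp X)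
    (s : Finset ℝ) (hs : s.card = 1000 * X) (hsZ : ∀ x ∈ s, x ∈ Set.Icc 0 Z)
    (hsep : ∀ x ∈ s, ∀ y ∈ s, x ≠ y → 1 ≤ |x - y|) (hT : T = 1000 * X * t)
    (hsmall : ∀ x ∈ s, |∑ i, p i * (x ^ (i.1 : ℕ) * exp (i.2 * c * x))| ≤ exp (32 * X - T))
    {z : ℝ} (hz : z ∈ Set.Icc 0 Z) :
    |∑ i, p i * (z ^ (i.1 : ℕ) * exp (i.2 * c * z))| ≤ exp (-3950 * X) := by
  have hX1 : (1 : ℝ) ≤ X := by exact_mod_cast hX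
  have ht1 : (10000 : ℝ) ≤ t := by exact_mod_cast ht
  have hKt' : (K : ℝ) * t = 8000 * X := by exact_mod_cast hKt
  have hZ0 : 0 < Z := by linarith
  have hw : (t : ℝ) * |c| ≤ 4 * X / Z := by rwa [le_div_iff₀ hZ0]
  have main := abs_le_of_small_on_nodes
    (fun x => ∑ i : Fin K × Fin t, (p i : ℝ) * (x ^ (i.1 : ℕ) * exp (i.2 * c * x)))
    (by fun_prop) s hZ hsZ hsep hsmall
    (fun x hx => abs_iteratedDeriv_expPoly_le (fun i => (p i : ℝ)) s.card hp hZ hw hx) hz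
  refine main.trans ?_
  rw [hs]
  have hZK : Z ^ K ≤ exp (8 * X) := by
    rw [← exp_log hZ0, ← exp_nat_mul]
    refine exp_le_exp.mpr ?_
    nlinarith [Nat.cast_nonneg (α := ℝ) K]
  have hZM : Z ^ (1000 * X) ≤ exp (X * t) := by
    rw [← exp_log hZ0, ← exp_nat_mul]
    refine exp_le_exp.mpr ?_
    push_cast
    nlinarith
  have h1 : ((1000 * X : ℕ) : ℝ) * (exp (32 * X - T) * Z ^ (1000 * X)) ≤ exp (-3960 * X) := by
    calc ((1000 * X : ℕ) : ℝ) * (exp (32 * X - T) * Z ^ (1000 * X))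
        ≤ exp X * (exp (32 * X - T) * exp (X * t)) := by
          gcongr
          refine le_trans ?_ hX8
          push_cast
          linarith
      _ = exp (33 * X - 999 * (X * t)) := by
          rw [← exp_add, ← exp_add, hT]; congr 1; ring
      _ ≤ exp (-3960 * X) := exp_le_exp.mpr (by nlinarith)
  have h2 : (K : ℝ) * t * (exp (17 * X) * (Z ^ K * exp (4 * X / Z * Z)
      * (K / Z + 4 * X / Z) ^ (1000 * X))) * Z ^ (1000 * X) / (1000 * X).factorial
      ≤ exp (-3960 * X) := by
    calc _ = (8000 * X : ℝ) * (exp (17 * X) * (Z ^ K * exp (4 * X)))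
          * (((K + 4 * X : ℝ)) ^ (1000 * X) / (1000 * X).factorial) := by
          rw [hKt', ← add_div, div_pow, div_mul_cancel₀ _ hZ0.ne']
          field_simp
      _ ≤ exp X * (exp (17 * X) * (exp (8 * X) * exp (4 * X)))
          * exp (-4 * (1000 * X : ℕ)) := by
          gcongr
          refine pow_self_div_factorial_le (by positivity) ?_
          push_cast
          have : (K : ℝ) ≤ X := by nlinarith [Nat.cast_nonneg (α := ℝ) K]
          linarith
      _ = exp (-3970 * X) := by
          simp only [← exp_add]; congr 1; push_cast; ring
      _ ≤ exp (-3960 * X) := exp_le_exp.mpr (by linarith)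
  calc _ ≤ exp (-3960 * X) + exp (-3960 * X) := add_le_add h1 h2
    _ = 2 * exp (-3960 * X) := by ring
    _ ≤ exp (10 * X) * exp (-3960 * X) := by
        gcongr
        have := add_one_le_exp (10 * X : ℝ)
        linarith
    _ = exp (-3950 * X) := by rw [← exp_add]; congr 1; ring

open Polynomial in
/-- Vanishing of the interpolation form on a large rectangle forces all coefficients to vanish. -/
theorem interpolation_coeff_eq_zero {α ν : Bool × Bool → ℝ} {δ b K t R S : ℕ}
    (p : Fin K × Fin t → ℤ) (hα0 : 0 < α (true, true)) (hα1 : α (true, true) ≠ 1)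
    (hν : 0 < ν (true, true)) (hδ : 1 ≤ δ) (hRb : R ≤ b) (htR : t ≤ R)
    (hcard : t * K < (R - t) * S)
    (hvan : ∀ r < R, ∀ s < S,
      ∑ i, p i * interpolationTerm α ν δ b (t * S) i.1 i.2 r s (true, true) = 0) : p = 0 := by
  classical
  let Q : Fin t → ℝ[X] := fun l => ∑ k : Fin K, Polynomial.C (p (k, l) : ℝ) * X ^ (k : ℕ)
  have hQ : ∀ l (k : Fin K), (Q l).coeff k = p (k, l) := by
    intro l k
    simp only [Q, finsetSum_coeff, coeff_C_mul_X_pow]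
    rw [Finset.sum_eq_single k]
    · simp
    · intro j _ hj
      rw [if_neg]
      exact fun h => hj (Fin.ext h.symm)
    · simp
  let pt : Fin (R - t) × Fin S → ℝ := fun x => ((x.1 + b * x.2 : ℕ) : ℝ)
  have hinj : Function.Injective pt := by
    rintro ⟨r, s⟩ ⟨r', s'⟩ h
    have h' : (r : ℕ) + b * s = r' + b * s' := Nat.cast_injective (R := ℝ) h
    have hr := r.2
    have hr' := r'.2
    have e1 := congrArg (· % b) h'
    have e2 := congrArg (· / b) h'
    have hb : 0 < b := by omega
    simp only [Nat.add_mul_mod_self_left, Nat.add_mul_div_left _ _ hb] at e1 e2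
    rw [Nat.mod_eq_of_lt (by omega), Nat.mod_eq_of_lt (by omega)] at e1
    rw [Nat.div_eq_of_lt (by omega), Nat.div_eq_of_lt (by omega)] at e2
    ext <;> simp <;> omega
  have hδ0 : (0 : ℝ) < δ := by exact_mod_cast hδ
  have hQ0 : ∀ l, Q l = 0 := by
    refine eq_zero_of_vanishing_on_translates Q hα0 hα1 (d := K) (fun l => ?_)
      (Finset.univ.image pt) ?_ ?_
    · refine natDegree_sum_le_of_forall_le _ _ fun k _ => ?_
      exact (natDegree_C_mul_X_pow_le _ _).trans k.2.le
    · rw [Finset.card_image_of_injective _ hinj]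
      simpa using hcard
    · intro x hx
      obtain ⟨⟨r, s⟩, -, rfl⟩ := Finset.mem_image.mp hx
      refine ⟨α (true, true) ^ (r : ℕ) * (ν (true, true) / δ) ^ (s : ℕ), by positivity,
        fun j hj => ?_⟩
      have h0 := hvan (r + j) (by have := r.2; omega) s s.2
      rw [← zero_div ((δ : ℝ) ^ (t * S)), ← h0, Finset.sum_div, Fintype.sum_prod_type_right]
      refine Finset.sum_congr rfl fun l _ => ?_
      rw [eval_finsetSum, Finset.sum_mul]
      refine Finset.sum_congr rfl fun k _ => ?_
      have hls : (l : ℕ) * s ≤ t * S := Nat.mul_le_mul l.2.le s.2.le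
      simp only [interpolationTerm, Pi.mul_apply, Pi.pow_apply, Pi.natCast_apply, pt, eval_mul,
        eval_C, eval_pow, eval_X]
      rw [eq_div_iff (by positivity)]
      nth_rewrite 1 [← Nat.add_sub_cancel' hls]
      rw [pow_add]
      push_cast
      simp only [mul_pow, div_pow]
      field_simp
      ring
  ext ⟨k, l⟩
  have := hQ l k
  rw [hQ0 l, coeff_zero] at this
  exact_mod_cast this.symm

theorem natCast_mul_le_exp {X : ℕ} (hX : 16000 ≤ X) : (8000 * X : ℝ) ≤ exp X := by
  have h := quadratic_le_exp_of_nonneg (Nat.cast_nonneg (α := ℝ) X)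
  have : (16000 : ℝ) ≤ X := by exact_mod_cast hX
  nlinarith

set_option maxHeartbeats 1000000 in
/-- A lower bound for linear forms in two logarithms of elements of a real biquadratic field. -/
theorem exp_lt_abs_linear_form {D₁ D₂ : ℕ} (h₁ : ¬ IsSquare D₁) (h₂ : ¬ IsSquare D₂)
    (h₁₂ : ¬ IsSquare (D₁ * D₂)) {α ν : Bool × Bool → ℝ} (hα : α ∈ biquadraticOrder D₁ D₂)
    (hν : ν ∈ biquadraticOrder D₁ D₂) {A G t δ b : ℕ} (hA : 1 ≤ A) (hG : 1 ≤ G)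
    (ht : 10000 ≤ t) (hδ : 1 ≤ δ) (hδG : (δ : ℝ) ≤ exp G) (hαA : ∀ σ, |α σ| ≤ exp A)
    (hνG : ∀ σ, |ν σ| ≤ exp G) (hα0 : 0 < α (true, true)) (hα1 : α (true, true) ≠ 1)
    (hν0 : 0 < ν (true, true)) (hb : 4000 * G * t ≤ b)
    (hlog : |log (α (true, true))| * b ≤ G)
    (hlogb : 1000 * log (b * (4000 * A * t) : ℕ) ≤ t) :
    exp (-(1000000 * A * G * t ^ 3 : ℕ))
      < |b * log (α (true, true)) - log (ν (true, true) / δ)| := by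
  by_contra! hV
  have hD₁ : 1 ≤ D₁ := Nat.one_le_iff_ne_zero.mpr fun h => h₁ (h ▸ ⟨0, rfl⟩)
  have hD₂ : 1 ≤ D₂ := Nat.one_le_iff_ne_zero.mpr fun h => h₂ (h ▸ ⟨0, rfl⟩)
  set X : ℕ := 1000 * A * G * t ^ 2 with hXdef
  set K : ℕ := 8000000 * A * G * t with hKdef
  set R₀ : ℕ := 1000 * G * t with hR₀
  set S₀ : ℕ := 1000 * A * t with hS₀
  set R : ℕ := 4000 * G * t with hR
  set S : ℕ := 4000 * A * t with hS
  set T : ℝ := 1000 * X * t with hT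
  set c := log (α (true, true)) with hc
  clear_value X K R₀ S₀ R S T
  have hTV : -((1000000 * A * G * t ^ 3 : ℕ) : ℝ) = -T := by
    rw [hT, hXdef]; push_cast; ring
  rw [hTV] at hV
  have hR0R : R₀ ≤ R := by
    rw [hR₀, hR]; gcongr; norm_num
  have hS0S : S₀ ≤ S := by
    rw [hS₀, hS]; gcongr; norm_num
  have htX : t ≤ X := by
    calc t = 1 * 1 * 1 * t := by ring
      _ ≤ X := by
        rw [hXdef]
        gcongr
        · norm_num
        · exact Nat.le_self_pow two_ne_zero t
  have hX16 : 16000 ≤ X := by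
    calc 16000 ≤ 1000 * 1 * 1 * 10000 ^ 2 := by norm_num
      _ ≤ X := by rw [hXdef]; gcongr
  have hX1 : (16000 : ℝ) ≤ X := by exact_mod_cast hX16
  have hX8 := natCast_mul_le_exp hX16
  have htR' : (10000 : ℝ) ≤ t := by exact_mod_cast ht
  have hKt : K * t = 8000 * X := by rw [hKdef, hXdef]; ring
  have hKt' : (K : ℝ) * t = 8000 * X := by exact_mod_cast hKt
  have hRpos : 0 < R := by rw [hR]; positivity
  have hSpos : 0 < S := by rw [hS]; positivity
  have hbpos : 0 < b := hRpos.trans_le hb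
  have hZ1 : (1 : ℝ) ≤ (b * S : ℕ) := by exact_mod_cast Nat.mul_pos hbpos hSpos
  have hGtS : (G : ℝ) * (t * S : ℕ) = 4 * X := by
    rw [hXdef, hS]; push_cast; ring
  have hcZ : t * |c| * (b * S : ℕ) ≤ 4 * X := by
    rw [← hGtS]
    push_cast
    have : (0 : ℝ) ≤ t * S := by positivity
    nlinarith
  have hnode : ∀ {r s : ℕ}, r < R → s < S → r + b * s ≤ b * S := by
    intro r s hr hs
    nlinarith
  have hpow : ∀ {r s k : ℕ}, r < R → s < S → k ≤ K →
      ((r + b * s : ℕ) : ℝ) ^ k ≤ exp (8 * X) := by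
    intro r s k hr hs hk
    calc ((r + b * s : ℕ) : ℝ) ^ k ≤ ((b * S : ℕ) : ℝ) ^ k := by
          gcongr
          exact hnode hr hs
      _ ≤ ((b * S : ℕ) : ℝ) ^ K := by gcongr
      _ = exp (K * log (b * S : ℕ)) := by rw [exp_nat_mul, exp_log (by linarith)]
      _ ≤ exp (8 * X) := by
        refine exp_le_exp.mpr ?_
        nlinarith [Nat.cast_nonneg (α := ℝ) K]
  have hterm : ∀ {r s : ℕ} (i : Fin K × Fin t) (σ), r < R → s < S →
      |interpolationTerm α ν δ b (t * S) i.1 i.2 r s σ| ≤ exp (16 * X) := by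
    intro r s i σ hr hs
    refine (abs_interpolationTerm_le (x := 8 * X) (y := 4 * X) (z := 4 * X) hδG hαA hνG
      (Nat.mul_le_mul i.2.2.le hs.le) (hpow hr hs i.1.2.le) ?_ hGtS.le σ).trans_eq
      (by congr 1; ring)
    have h1 : ((i.2 : ℕ) : ℝ) * r ≤ t * R := by
      exact_mod_cast Nat.mul_le_mul i.2.2.le hr.le
    calc (A : ℝ) * ((i.2 : ℕ) * r) ≤ A * (t * R) := by gcongr
      _ = 4 * X := by rw [hXdef, hR]; push_cast; ring
  have hcardι : Fintype.card (Fin K × Fin t) = 8 * Fintype.card (Fin R₀ × Fin S₀) := by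
    simp only [Fintype.card_prod, Fintype.card_fin]
    rw [hKt, hXdef, hR₀, hS₀]; ring
  obtain ⟨p, hp0, hp, hvan⟩ := biquadraticOrder.exists_int_relation hD₁ hD₂
    (X := Fin R₀ × Fin S₀) (ι := Fin K × Fin t)
    (by
      simp only [Fintype.card_prod, Fintype.card_fin]
      rw [hR₀, hS₀]; positivity)
    hcardι (fun x i => interpolationTerm α ν δ b (t * S) i.1 i.2 x.1 x.2)
    (fun x i => interpolationTerm_mem hα hν) (H := exp (16 * X))
    (one_le_exp (by positivity))
    (fun x i σ => hterm i σ (x.1.2.trans_le hR0R) (x.2.2.trans_le hS0S))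
  have hcardι' : ((Fintype.card (Fin K × Fin t) : ℕ) : ℝ) = 8000 * X := by
    simp only [Fintype.card_prod, Fintype.card_fin]
    exact_mod_cast hKt
  have hp17 : ∀ i, (|p i| : ℝ) ≤ exp (17 * X) := by
    intro i
    refine (hp i).trans ?_
    rw [hcardι']
    calc (8000 * X : ℝ) * exp (16 * X) ≤ exp X * exp (16 * X) := by gcongr
      _ = exp (17 * X) := by rw [← exp_add]; congr 1; ring
  have hTX : 32 * (X : ℝ) - T ≤ -4000 * X := by
    rw [hT]
    nlinarith
  have hle : ((t * S : ℕ) : ℝ) ≤ exp X := by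
    refine le_trans ?_ hX8
    have : t * S ≤ 8000 * X := by
      rw [hXdef, hS]
      have : 1 ≤ G := hG
      calc t * (4000 * A * t) = 4000 * A * 1 * t ^ 2 := by ring
        _ ≤ 8000 * (1000 * A * G * t ^ 2) := by
          rw [← mul_assoc, ← mul_assoc, ← mul_assoc]; gcongr; norm_num
    exact_mod_cast this
  let F : ℝ → ℝ := fun x => ∑ i : Fin K × Fin t, p i * (x ^ (i.1 : ℕ) * exp (i.2 * c * x))
  have hcomp : ∀ {r s : ℕ}, r < R → s < S →
      |(∑ i, p i * interpolationTerm α ν δ b (t * S) i.1 i.2 r s (true, true)) / δ ^ (t * S)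
        - F (r + b * s : ℕ)| ≤ exp (32 * X - T) := by
    intro r s hr hs
    simp only [F]
    rw [Finset.sum_div, ← Finset.sum_sub_distrib]
    refine (Finset.abs_sum_le_sum_abs _ _).trans ?_
    have hi : ∀ i : Fin K × Fin t,
        |p i * interpolationTerm α ν δ b (t * S) i.1 i.2 r s (true, true) / δ ^ (t * S)
          - p i * (((r + b * s : ℕ) : ℝ) ^ (i.1 : ℕ) * exp (i.2 * c * (r + b * s : ℕ)))|
        ≤ exp (17 * X) * (exp (8 * X) * (exp X * exp (-T) * exp (4 * X + 1))) := by
      intro i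
      rw [mul_div_assoc, ← mul_sub, abs_mul]
      refine mul_le_mul (hp17 i) ?_ (abs_nonneg _) (exp_nonneg _)
      refine (abs_interpolationTerm_apply_div_sub_le hδ hα0 hν0
        (Nat.mul_le_mul i.2.2.le hs.le) (hpow hr hs i.1.2.le) hV ?_ (y := 4 * X) ?_).trans ?_
      · calc ((t * S : ℕ) : ℝ) * exp (-T) ≤ exp X * exp (-T) := by gcongr
          _ = exp (X - T) := by rw [← exp_add]; rfl
          _ ≤ 1 := exp_le_one_iff.mpr (by linarith)
      · refine le_trans ?_ hcZ
        have := i.2.2.le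
        have := hnode hr hs
        gcongr
      · gcongr
    refine (Finset.sum_le_sum fun i _ => hi i).trans ?_
    rw [Finset.sum_const, Finset.card_univ, nsmul_eq_mul, hcardι']
    calc (8000 * X : ℝ) * (exp (17 * X) * (exp (8 * X) * (exp X * exp (-T) * exp (4 * X + 1))))
        ≤ exp X * (exp (17 * X) * (exp (8 * X) * (exp X * exp (-T) * exp (4 * X + 1)))) := by
          gcongr
      _ = exp (31 * X + 1 - T) := by
          simp only [← exp_add]; congr 1; ring
      _ ≤ exp (32 * X - T) := exp_le_exp.mpr (by linarith)
  have hnodes_inj : Function.Injective fun x : Fin R₀ × Fin S₀ => (x.1 + b * x.2 : ℕ) := by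
    rintro ⟨r, s⟩ ⟨r', s'⟩ h
    have h' : (r : ℕ) + b * s = r' + b * s' := h
    have hr : (r : ℕ) < b := r.2.trans_le (hR0R.trans hb)
    have hr' : (r' : ℕ) < b := r'.2.trans_le (hR0R.trans hb)
    have e1 := congrArg (· % b) h'
    have e2 := congrArg (· / b) h'
    simp only [Nat.add_mul_mod_self_left, Nat.add_mul_div_left _ _ hbpos] at e1 e2
    rw [Nat.mod_eq_of_lt hr, Nat.mod_eq_of_lt hr'] at e1
    rw [Nat.div_eq_of_lt hr, Nat.div_eq_of_lt hr'] at e2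
    ext
    · exact e1
    · simpa using e2
  let nodes : Finset ℝ := (Finset.univ.image fun x : Fin R₀ × Fin S₀ =>
    (x.1 + b * x.2 : ℕ)).map Nat.castEmbedding
  have hnodes : nodes.card = 1000 * X := by
    rw [Finset.card_map, Finset.card_image_of_injective _ hnodes_inj, Finset.card_univ]
    simp only [Fintype.card_prod, Fintype.card_fin]
    rw [hR₀, hS₀, hXdef]; ring
  have hmem : ∀ x ∈ nodes, ∃ r < R₀, ∃ s < S₀, x = (r + b * s : ℕ) := by
    intro x hx
    simp only [nodes, Finset.mem_map, Finset.mem_image, Finset.mem_univ, true_and,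
      Nat.castEmbedding_apply] at hx
    obtain ⟨_, ⟨⟨r, s⟩, rfl⟩, rfl⟩ := hx
    exact ⟨r, r.2, s, s.2, rfl⟩
  have hF : ∀ z ∈ Set.Icc (0 : ℝ) (b * S : ℕ), |F z| ≤ exp (-3950 * X) := by
    intro z hz
    refine abs_expPoly_le p ht (by omega) hKt hp17 hZ1 hlogb hcZ hX8 nodes hnodes ?_ ?_ hT ?_ hz
    · intro x hx
      obtain ⟨r, hr, s, hs, rfl⟩ := hmem x hx
      exact ⟨Nat.cast_nonneg _, by
        exact_mod_cast hnode (hr.trans_le hR0R) (hs.trans_le hS0S)⟩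
    · intro x hx y hy hxy
      obtain ⟨r, hr, s, hs, rfl⟩ := hmem x hx
      obtain ⟨r', hr', s', hs', rfl⟩ := hmem y hy
      have hne : ((r + b * s : ℕ) : ℤ) - ((r' + b * s' : ℕ) : ℤ) ≠ 0 := by
        intro h
        refine hxy ?_
        exact_mod_cast sub_eq_zero.mp h
      exact_mod_cast Int.one_le_abs hne
    · intro x hx
      obtain ⟨r, hr, s, hs, rfl⟩ := hmem x hx
      have h1 := hcomp (hr.trans_le hR0R) (hs.trans_le hS0S)
      have h2 : ∑ i, p i * interpolationTerm α ν δ b (t * S) i.1 i.2 r s (true, true) = 0 :=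
        hvan (⟨r, hr⟩, ⟨s, hs⟩)
      rwa [h2, zero_div, zero_sub, abs_neg] at h1
  have hzero : ∀ r < R, ∀ s < S,
      ∑ i, p i * interpolationTerm α ν δ b (t * S) i.1 i.2 r s (true, true) = 0 := by
    intro r hr s hs
    let Φ : Bool × Bool → ℝ := ∑ i : Fin K × Fin t,
      (p i : Bool × Bool → ℝ) * interpolationTerm α ν δ b (t * S) i.1 i.2 r s
    have hΦmem : Φ ∈ biquadraticOrder D₁ D₂ :=
      sum_mem fun i _ => mul_mem (intCast_mem _ _) (interpolationTerm_mem hα hν)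
    have hΦ : ∀ σ, Φ σ = ∑ i, p i * interpolationTerm α ν δ b (t * S) i.1 i.2 r s σ := by
      intro σ
      simp only [Φ, Finset.sum_apply, Pi.mul_apply, Pi.intCast_apply]
    have hΦH : ∀ σ, |Φ σ| ≤ exp (34 * X) := by
      intro σ
      rw [hΦ]
      refine (Finset.abs_sum_le_sum_abs _ _).trans ?_
      have hi : ∀ i : Fin K × Fin t,
          |p i * interpolationTerm α ν δ b (t * S) i.1 i.2 r s σ|
            ≤ exp (17 * X) * exp (16 * X) := by
        intro i
        rw [abs_mul]
        exact mul_le_mul (hp17 i) (hterm i σ hr hs) (abs_nonneg _) (exp_nonneg _)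
      refine (Finset.sum_le_sum fun i _ => hi i).trans ?_
      rw [Finset.sum_const, Finset.card_univ, nsmul_eq_mul, hcardι']
      calc (8000 * X : ℝ) * (exp (17 * X) * exp (16 * X))
          ≤ exp X * (exp (17 * X) * exp (16 * X)) := by gcongr
        _ = exp (34 * X) := by simp only [← exp_add]; congr 1; ring
    have hΦsmall : |Φ (true, true)| ≤ exp (-3900 * X) := by
      have h1 := hcomp hr hs
      rw [← hΦ] at h1
      have h2 := hF (r + b * s : ℕ) ⟨Nat.cast_nonneg _, by exact_mod_cast hnode hr hs⟩
      have hδ0 : (0 : ℝ) < δ := by exact_mod_cast hδ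
      have h3 : |Φ (true, true) / δ ^ (t * S)| ≤ exp (-3949 * X) := by
        have e1 : exp (32 * X - T) ≤ exp (-3950 * X) := exp_le_exp.mpr (by linarith)
        have e2 : 2 * exp (-3950 * X) ≤ exp (-3949 * X) := by
          calc 2 * exp (-3950 * X) ≤ exp X * exp (-3950 * X) := by
                gcongr
                linarith
            _ = exp (-3949 * X) := by rw [← exp_add]; congr 1; ring
        have e3 := abs_sub_abs_le_abs_sub (Φ (true, true) / δ ^ (t * S)) (F (r + b * s : ℕ))
        linarith
      have h4 : (δ : ℝ) ^ (t * S) ≤ exp (4 * X) := by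
        calc (δ : ℝ) ^ (t * S) ≤ exp G ^ (t * S) := by gcongr
          _ = exp (4 * X) := by rw [← exp_nat_mul, mul_comm, hGtS]
      rw [abs_div, abs_of_pos (pow_pos hδ0 _), div_le_iff₀ (pow_pos hδ0 _)] at h3
      refine h3.trans ?_
      calc exp (-3949 * X) * δ ^ (t * S) ≤ exp (-3949 * X) * exp (4 * X) := by gcongr
        _ = exp (-3945 * X) := by rw [← exp_add]; congr 1; ring
        _ ≤ exp (-3900 * X) := exp_le_exp.mpr (by linarith)
    rw [← hΦ]
    refine biquadraticOrder.apply_eq_zero_of_small h₁ h₂ h₁₂ hΦmem hΦH ?_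
    calc |Φ (true, true)| * exp (34 * X) ^ 3 ≤ exp (-3900 * X) * exp (34 * X) ^ 3 := by gcongr
      _ = exp (-3798 * X) := by
        rw [← exp_nat_mul, ← exp_add]; congr 1; push_cast; ring
      _ < 1 := by
        rw [Real.exp_lt_one_iff]
        linarith
  refine hp0 (interpolation_coeff_eq_zero p hα0 hα1 hν0 hδ hb ?_ ?_ hzero)
  · calc t = 1 * 1 * t := by ring
      _ ≤ R := by rw [hR]; gcongr; norm_num
  · have h3 : 3000 * G * t ≤ R - t := by
      have : t ≤ 1000 * G * t := by
        calc t = 1 * 1 * t := by ring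
          _ ≤ 1000 * G * t := by gcongr; norm_num
      have : R = 3000 * G * t + 1000 * G * t := by rw [hR]; ring
      omega
    calc t * K = 8000000 * (A * G * t ^ 2) := by rw [hKdef]; ring
      _ < 12000000 * (A * G * t ^ 2) := by
        have : 0 < A * G * t ^ 2 := by positivity
        omega
      _ = 3000 * G * t * S := by rw [hS]; ring
      _ ≤ (R - t) * S := by gcongr

theorem Nat.card_divisors_pow_eight_le {m : ℕ} (hm : m ≠ 0) :
    m.divisors.card ^ 8 ≤ (8 ^ 8) ^ 256 * m := by
  have hpow : ∀ a : ℕ, (a + 1) ^ 8 ≤ 8 ^ 8 * 2 ^ a := by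
    intro a
    have h1 : a + 1 ≤ 8 * 2 ^ (a / 8) := by
      have : a / 8 < 2 ^ (a / 8) := Nat.lt_two_pow_self
      omega
    calc (a + 1) ^ 8 ≤ (8 * 2 ^ (a / 8)) ^ 8 := by gcongr
      _ = 8 ^ 8 * 2 ^ (8 * (a / 8)) := by rw [mul_pow, ← pow_mul, mul_comm (a / 8)]
      _ ≤ 8 ^ 8 * 2 ^ a := by
        gcongr
        · norm_num
        · exact Nat.mul_div_le a 8
  have hterm : ∀ p ∈ m.primeFactors, (m.factorization p + 1) ^ 8
      ≤ (if p < 256 then 8 ^ 8 else 1) * p ^ m.factorization p := by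
    intro p hp
    have hp2 := (Nat.prime_of_mem_primeFactors hp).two_le
    split_ifs with h
    · refine (hpow _).trans ?_
      gcongr
    · rw [one_mul]
      calc (m.factorization p + 1) ^ 8 ≤ (2 ^ m.factorization p) ^ 8 := by
            gcongr
            exact Nat.lt_two_pow_self
        _ = 256 ^ m.factorization p := by rw [← pow_mul, mul_comm, pow_mul]; norm_num
        _ ≤ p ^ m.factorization p := by
          gcongr
          omega
  rw [Nat.card_divisors hm, ← Finset.prod_pow]
  refine (Finset.prod_le_prod' hterm).trans ?_
  rw [Finset.prod_mul_distrib]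
  refine Nat.mul_le_mul ?_ (le_of_eq (Nat.prod_factorization_pow_eq_self hm))
  rw [Finset.prod_ite, Finset.prod_const, Finset.prod_const_one, mul_one]
  refine Nat.pow_le_pow_right (by norm_num) ?_
  refine (Finset.card_le_card (t := Finset.range 256) fun p hp => ?_).trans_eq (by simp)
  simpa using (Finset.mem_filter.mp hp).2

theorem exists_int_approx_sqrt (D : ℕ) {Q : ℕ} (hQ : 0 < Q) : ∃ p q : ℤ, IsCoprime p q ∧ 1 ≤ q ∧
    q ≤ Q ∧ |(p : ℝ) - q * √D| ≤ 1 / (Q + 1) := by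
  obtain ⟨x, hx1, hx2⟩ := Real.exists_rat_abs_sub_le_and_den_le (√D) hQ
  refine ⟨x.num, x.den, Rat.isCoprime_num_den x, by exact_mod_cast x.pos, by exact_mod_cast hx2, ?_⟩
  have hd : (0 : ℝ) < x.den := by exact_mod_cast x.pos
  have hx : (x : ℝ) = x.num / x.den := by exact_mod_cast (Rat.num_div_den x).symm
  rw [hx] at hx1
  have : (x.num : ℝ) - (x.den : ℤ) * √D = - (x.den * (√D - x.num / x.den)) := by
    push_cast; field_simp; ring
  rw [this, abs_neg, abs_mul, abs_of_pos hd]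
  calc (x.den : ℝ) * |√D - x.num / x.den| ≤ x.den * (1 / ((Q + 1) * x.den)) := by gcongr
    _ = 1 / (Q + 1) := by field_simp

/-- Two elements of the same norm with the same residue differ by a unit. -/
theorem exists_pell_of_same_residue {D : ℕ} {p q p' q' r N : ℤ} (hN : N ≠ 0)
    (h : p ^ 2 - D * q ^ 2 = N) (h' : p' ^ 2 - D * q' ^ 2 = N) (hr : N ∣ p - r * q)
    (hr' : N ∣ p' - r * q') (hD : N ∣ r ^ 2 - D) :
    ∃ x y : ℤ, x ^ 2 - D * y ^ 2 = 1 ∧ (p' : ℝ) - q' * √D ≠ 0 ∧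
      ((x : ℝ) + y * √D) * (p' - q' * √D) = p - q * √D := by
  obtain ⟨a, ha⟩ := hr
  obtain ⟨b, hb⟩ := hr'
  obtain ⟨c, hc⟩ := hD
  have hp : p = r * q + N * a := by linarith
  have hp' : p' = r * q' + N * b := by linarith
  have hD' : (D : ℤ) = r ^ 2 - N * c := by linarith
  obtain ⟨x, hx⟩ : N ∣ p' * p - D * q' * q :=
    ⟨r * q' * a + b * r * q + N * a * b + c * q' * q, by rw [hp, hp', hD']; ring⟩
  obtain ⟨y, hy⟩ : N ∣ q' * p - p' * q := ⟨q' * a - b * q, by rw [hp, hp']; ring⟩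
  have hs : (√D : ℝ) ^ 2 = D := Real.sq_sqrt (Nat.cast_nonneg _)
  have hNR : (N : ℝ) ≠ 0 := by exact_mod_cast hN
  have h'R : ((p' : ℝ) + q' * √D) * (p' - q' * √D) = N := by
    have : (p' : ℝ) ^ 2 - D * (q' : ℝ) ^ 2 = N := by exact_mod_cast h'
    linear_combination this - (q' : ℝ) ^ 2 * hs
  refine ⟨x, y, ?_, fun h0 => hNR (by rw [← h'R, h0, mul_zero]), ?_⟩
  · refine mul_left_cancel₀ (pow_ne_zero 2 hN) ?_
    calc N ^ 2 * (x ^ 2 - D * y ^ 2) = (N * x) ^ 2 - D * (N * y) ^ 2 := by ring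
      _ = (p ^ 2 - D * q ^ 2) * (p' ^ 2 - D * q' ^ 2) := by rw [← hx, ← hy]; ring
      _ = N ^ 2 * 1 := by rw [h, h']; ring
  · have hxR : (N : ℝ) * x = p' * p - D * q' * q := by exact_mod_cast hx.symm
    have hyR : (N : ℝ) * y = q' * p - p' * q := by exact_mod_cast hy.symm
    refine mul_left_cancel₀ hNR ?_
    calc (N : ℝ) * ((x + y * √D) * (p' - q' * √D))
        = (N * x + N * y * √D) * (p' - q' * √D) := by ring
      _ = ((p' + q' * √D) * (p' - q' * √D)) * (p - q * √D) := by
        rw [hxR, hyR]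
        linear_combination (q' * q * (p' - q' * √D)) * hs
      _ = N * (p - q * √D) := by rw [h'R]

/-- The number of admissible residues `r` and norms of size at most `2 √D`. -/
noncomputable def residueCount (D : ℕ) : ℕ :=
  ∑ r ∈ Finset.range (⌊2 * √(D : ℝ)⌋₊ + 1), 2 * ((r : ℤ) ^ 2 - D).natAbs.divisors.card

theorem exists_residue {D : ℕ} {p q N : ℤ} (hN : N ≠ 0) (hND : (|N| : ℝ) ≤ 2 * √D)
    (hpq : IsCoprime p q) (h : p ^ 2 - D * q ^ 2 = N) :
    ∃ r ∈ Finset.range (⌊2 * √(D : ℝ)⌋₊ + 1), N ∣ p - r * q ∧ N ∣ (r : ℤ) ^ 2 - D := by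
  have hcop : IsCoprime q N := by
    rw [← h]
    have h1 : IsCoprime q (p ^ 2) := hpq.symm.pow_right
    have : p ^ 2 - D * q ^ 2 = p ^ 2 + q * (-(D * q)) := by ring
    rw [this]
    exact h1.add_mul_left_right _
  obtain ⟨u, v, huv⟩ := hcop
  have hr0 := Int.emod_nonneg (p * u) hN
  obtain ⟨r, hr⟩ := Int.eq_ofNat_of_zero_le hr0
  have hdvd : N ∣ p * u - r := by
    rw [← hr]
    exact Int.dvd_self_sub_emod
  have hpr : N ∣ p - r * q := by
    obtain ⟨c, hc⟩ := hdvd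
    exact ⟨p * v + c * q, by linear_combination (-p) * huv + q * hc⟩
  refine ⟨r, ?_, hpr, ?_⟩
  · rw [Finset.mem_range, Nat.lt_succ_iff]
    refine Nat.le_floor ?_
    have h1 := (Int.emod_lt_abs (p * u) hN).le
    rw [hr] at h1
    have h2 : ((r : ℕ) : ℝ) ≤ |(N : ℝ)| := by exact_mod_cast h1
    exact h2.trans hND
  · have hq2 : N ∣ q ^ 2 * ((r : ℤ) ^ 2 - D) := by
      obtain ⟨c, hc⟩ := hpr
      refine ⟨1 - c * (p + r * q), ?_⟩
      linear_combination h - (p + r * q) * hc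
    refine (IsCoprime.pow_right (n := 2) (?_ : IsCoprime N q)).dvd_of_dvd_mul_left hq2
    exact ⟨v, u, by linarith⟩

/-- A bound for the fundamental solution of Pell's equation. -/
theorem exists_pell_le {D : ℕ} (hD : ¬ IsSquare D) : ∃ x y : ℤ, x ^ 2 - D * y ^ 2 = 1 ∧
    0 < x ∧ 0 < y ∧ log (x + y * √D) ≤ (residueCount D + 2) * log (2 * D + 1) := by
  have hD1 : 1 ≤ D := Nat.one_le_iff_ne_zero.mpr fun h => hD (h ▸ ⟨0, rfl⟩)
  have hD1R : (1 : ℝ) ≤ D := by exact_mod_cast hD1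
  have hs : (√D : ℝ) ^ 2 = D := Real.sq_sqrt (Nat.cast_nonneg _)
  have hs1 : 1 ≤ (√D : ℝ) := Real.one_le_sqrt.mpr hD1R
  set s : ℝ := √D with hsdef
  have hsD : s ≤ D := by nlinarith
  set G : ℕ := 2 * D + 1 with hG
  have hGR : (G : ℝ) = 2 * D + 1 := by rw [hG]; push_cast; ring
  have hGpos : 0 < G := by omega
  choose p q hcop hq1 hqQ hpq using fun k : ℕ => exists_int_approx_sqrt D (pow_pos hGpos k)
  simp only [← hsdef] at hpq
  let N : ℕ → ℤ := fun k => p k ^ 2 - D * q k ^ 2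
  have hN0 : ∀ k, N k ≠ 0 := by
    intro k h
    have := (int_eq_zero_of_sq_eq_mul_sq hD (sub_eq_zero.mp h)).2
    have := hq1 k
    omega
  have hNR : ∀ k, (N k : ℝ) = (p k - q k * s) * (p k + q k * s) := by
    intro k
    simp only [N]
    push_cast
    linear_combination ((q k : ℝ) ^ 2) * hs
  have hQ : ∀ k, (1 : ℝ) ≤ (G : ℝ) ^ k := fun k => one_le_pow₀ (by exact_mod_cast hGpos)
  have hqR : ∀ k, (q k : ℝ) ≤ (G : ℝ) ^ k := fun k => by exact_mod_cast hqQ k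
  have hq1R : ∀ k, (1 : ℝ) ≤ q k := fun k => by exact_mod_cast hq1 k
  have hpq' : ∀ k, |(p k : ℝ) - q k * s| ≤ 1 / ((G : ℝ) ^ k + 1) := by
    intro k
    have := hpq k
    push_cast at this
    exact this
  have hconj : ∀ k, |(p k : ℝ) + q k * s| ≤ 2 * (G : ℝ) ^ k * s + 1 := by
    intro k
    have h1 : |(p k : ℝ) - q k * s| ≤ 1 := (hpq' k).trans (by
      rw [div_le_one (by linarith [hQ k])]; linarith [hQ k])
    have h2 := abs_le.mp h1
    have h3 : (q k : ℝ) * s ≤ G ^ k * s := by gcongr; exact hqR k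
    have h4 : 0 ≤ (q k : ℝ) * s := by have := hq1R k; positivity
    rw [abs_le]
    constructor <;> nlinarith
  have hNle : ∀ k, |(N k : ℝ)| ≤ 2 * s := by
    intro k
    rw [hNR, abs_mul]
    have hk := hQ k
    calc _ ≤ 1 / ((G : ℝ) ^ k + 1) * (2 * (G : ℝ) ^ k * s + 1) :=
          mul_le_mul (hpq' k) (hconj k) (abs_nonneg _) (by positivity)
      _ ≤ 2 * s := by
        rw [one_div_mul_eq_div, div_le_iff₀ (by linarith)]
        nlinarith
  have hlow : ∀ k, 1 / (2 * (G : ℝ) ^ k * s + 1) ≤ |(p k : ℝ) - q k * s| := by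
    intro k
    have hk := hQ k
    rw [div_le_iff₀ (by positivity)]
    have h1 : (1 : ℝ) ≤ |(N k : ℝ)| := by exact_mod_cast Int.one_le_abs (hN0 k)
    rw [hNR, abs_mul] at h1
    exact h1.trans (mul_le_mul_of_nonneg_left (hconj k) (abs_nonneg _))
  have hanti : ∀ k l, k < l → |(p l : ℝ) - q l * s| < |(p k : ℝ) - q k * s| := by
    intro k l hkl
    refine (hpq' l).trans_lt (lt_of_lt_of_le ?_ (hlow k))
    have hk := hQ k
    refine one_div_lt_one_div_of_lt (by positivity) ?_
    have h1 : (G : ℝ) ^ (k + 1) ≤ G ^ l := by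
      gcongr
      · exact_mod_cast hGpos
      · exact hkl
    rw [pow_succ] at h1
    have h2 : (G : ℝ) ^ k * (2 * s) < G ^ k * G := by
      refine mul_lt_mul_of_pos_left ?_ (by linarith)
      rw [hGR]; linarith
    linarith
  choose r hr hrp hrD using fun k => exists_residue (hN0 k) (hNle k) (hcop k) rfl
  let key : ℕ → (Σ _ : ℕ, ℕ × Bool) := fun k => ⟨r k, ((N k).natAbs, decide (0 < N k))⟩
  let S : Finset (Σ _ : ℕ, ℕ × Bool) := (Finset.range (⌊2 * s⌋₊ + 1)).sigma fun r =>
    ((r : ℤ) ^ 2 - D).natAbs.divisors ×ˢ Finset.univ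
  have hS : S.card = residueCount D := by
    simp only [S, residueCount, Finset.card_sigma, Finset.card_product, Finset.card_univ,
      Fintype.card_bool, mul_comm, ← hsdef]
  have hmaps : ∀ k ∈ Finset.range (residueCount D + 1), key k ∈ S := by
    intro k _
    simp only [S, key, Finset.mem_sigma, Finset.mem_product, Finset.mem_univ, and_true]
    refine ⟨hr k, Nat.mem_divisors.mpr ⟨Int.natAbs_dvd_natAbs.mpr (hrD k), ?_⟩⟩
    intro h0
    rw [Int.natAbs_eq_zero, sub_eq_zero] at h0
    exact hD ⟨r k, by exact_mod_cast (by rw [← h0]; ring : (D : ℤ) = r k * r k)⟩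
  obtain ⟨k, hk, l, hl, hne, hkey⟩ := Finset.exists_ne_map_eq_of_card_lt_of_maps_to
    (by rw [hS, Finset.card_range]; exact Nat.lt_succ_self _) hmaps
  wlog hkl : k < l generalizing k l
  · exact this l hl k hk hne.symm hkey.symm (by omega)
  simp only [key, Sigma.mk.injEq, heq_eq_eq, Prod.mk.injEq, decide_eq_decide] at hkey
  obtain ⟨hrr, hNN, hsgn⟩ := hkey
  have hNkl : N l = N k := by
    have := hN0 k
    have := hN0 l
    omega
  obtain ⟨x, y, hxy, hl0, hmul⟩ := exists_pell_of_same_residue (hN0 k) rfl hNkl (hrp k)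
    (by rw [hrr, ← hNkl]; exact hrp l) (hrD k)
  rw [← hsdef] at hl0 hmul
  have hul : 1 < |(x : ℝ) + y * s| := by
    have h1 := hanti k l hkl
    rw [← hmul, abs_mul] at h1
    have h2 := abs_pos.mpr hl0
    nlinarith
  have hxyR : ((x : ℝ) + y * s) * (x - y * s) = 1 := by
    have : (x : ℝ) ^ 2 - D * (y : ℝ) ^ 2 = 1 := by exact_mod_cast hxy
    linear_combination this - (y : ℝ) ^ 2 * hs
  have hy0 : y ≠ 0 := by
    rintro rfl
    simp only [Int.cast_zero, zero_mul, add_zero, sub_zero] at hul hxyR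
    have : |(x : ℝ)| * |(x : ℝ)| = 1 := by rw [← abs_mul, hxyR, abs_one]
    nlinarith
  have hx0 : x ≠ 0 := by
    rintro rfl
    have h1 : 0 < y ^ 2 := by positivity
    have h2 : (0 : ℤ) < D := by exact_mod_cast hD1
    nlinarith
  have hu : |(x : ℝ) + y * s| ≤ 2 * (G : ℝ) ^ l * s + 1 := by
    have hQl := hQ l
    have h1 : |(p k : ℝ) - q k * s| ≤ 1 := (hpq' k).trans (by
      rw [div_le_one (by linarith [hQ k])]; linarith [hQ k])
    rw [← hmul, abs_mul] at h1
    have h2 := hlow l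
    rw [div_le_iff₀ (by positivity)] at h2
    have h3 := abs_nonneg ((x : ℝ) + y * s)
    calc |(x : ℝ) + y * s| = |(x : ℝ) + y * s| * 1 := (mul_one _).symm
      _ ≤ |(x : ℝ) + y * s| * (|(p l : ℝ) - q l * s| * (2 * (G : ℝ) ^ l * s + 1)) := by gcongr
      _ = (|(x : ℝ) + y * s| * |(p l : ℝ) - q l * s|) * (2 * (G : ℝ) ^ l * s + 1) := by ring
      _ ≤ 1 * (2 * (G : ℝ) ^ l * s + 1) := by gcongr
      _ = _ := one_mul _
  have hu' : |(x : ℝ) - y * s| ≤ 1 := by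
    have : |(x : ℝ) + y * s| * |(x : ℝ) - y * s| = 1 := by rw [← abs_mul, hxyR, abs_one]
    nlinarith [abs_nonneg ((x : ℝ) - y * s)]
  have hpos : 0 < |(x : ℝ)| + |(y : ℝ)| * s := by
    have : (0 : ℝ) < |(x : ℝ)| := by exact_mod_cast abs_pos.mpr hx0
    positivity
  have hsum : |(x : ℝ)| + |(y : ℝ)| * s ≤ (G : ℝ) ^ (l + 2) := by
    have h1 : |(x : ℝ)| + |(y : ℝ)| * s ≤ |(x : ℝ) + y * s| + |(x : ℝ) - y * s| := by
      have e1 : 2 * |(x : ℝ)| ≤ |(x : ℝ) + y * s| + |(x : ℝ) - y * s| := by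
        calc 2 * |(x : ℝ)| = |((x : ℝ) + y * s) + (x - y * s)| := by
              rw [show ((x : ℝ) + y * s) + (x - y * s) = 2 * x by ring, abs_mul, abs_two]
          _ ≤ _ := abs_add_le _ _
      have e2 : 2 * (|(y : ℝ)| * s) ≤ |(x : ℝ) + y * s| + |(x : ℝ) - y * s| := by
        calc 2 * (|(y : ℝ)| * s) = |((x : ℝ) + y * s) - (x - y * s)| := by
              rw [show ((x : ℝ) + y * s) - (x - y * s) = 2 * (y * s) by ring, abs_mul, abs_two,
                abs_mul, abs_of_nonneg (by linarith : 0 ≤ s)]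
          _ ≤ _ := abs_sub _ _
      linarith
    have hQl := hQ l
    have h2 : 2 * (G : ℝ) ^ l * s + 1 + 1 ≤ (G : ℝ) ^ (l + 2) := by
      have e1 : (4 * s : ℝ) ≤ (G : ℝ) ^ 2 := by rw [hGR]; nlinarith
      calc 2 * (G : ℝ) ^ l * s + 1 + 1 ≤ (G : ℝ) ^ l * (4 * s) := by nlinarith
        _ ≤ (G : ℝ) ^ (l + 2) := by rw [pow_add]; gcongr
    linarith
  refine ⟨|x|, |y|, by rw [sq_abs, sq_abs]; exact hxy, abs_pos.mpr hx0, abs_pos.mpr hy0, ?_⟩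
  push_cast
  calc log (|(x : ℝ)| + |(y : ℝ)| * s) ≤ log ((G : ℝ) ^ (l + 2)) := log_le_log hpos hsum
    _ = ((l + 2 : ℕ) : ℝ) * log (2 * D + 1) := by rw [log_pow, hGR]
    _ ≤ (residueCount D + 2) * log (2 * D + 1) := by
      have h1 : l ≤ residueCount D := by
        rw [Finset.mem_range] at hl; omega
      have h2 : ((l + 2 : ℕ) : ℝ) ≤ residueCount D + 2 := by exact_mod_cast Nat.add_le_add_right h1 2
      gcongr
      exact log_nonneg (by linarith)

theorem exists_residueCount_le : ∃ C : ℕ, ∀ D t : ℕ, ¬ IsSquare D → D ≤ t ^ 30 →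
    residueCount D ≤ C * t ^ 19 := by
  obtain ⟨C, hC⟩ : ∃ C : ℕ, ∀ m : ℕ, m ≠ 0 → m.divisors.card ^ 8 ≤ C * m :=
    ⟨_, fun m hm => Nat.card_divisors_pow_eight_le hm⟩
  refine ⟨3 * (2 * (4 * C + 1)), fun D t hD hDt => ?_⟩
  have ht : 1 ≤ t := by
    rcases Nat.eq_zero_or_pos t with rfl | h
    · exact absurd ⟨0, by simpa using hDt⟩ hD
    · exact h
  have hsqrt : (√(D : ℝ)) ≤ t ^ 15 := by
    rw [Real.sqrt_le_left (by positivity), ← pow_mul]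
    exact_mod_cast hDt
  have hfloor : ⌊2 * √(D : ℝ)⌋₊ + 1 ≤ 3 * t ^ 15 := by
    have h1 : ⌊2 * √(D : ℝ)⌋₊ ≤ 2 * t ^ 15 := Nat.floor_le_of_le (by push_cast; linarith)
    have h2 : 1 ≤ t ^ 15 := Nat.one_le_pow _ _ ht
    omega
  have hterm : ∀ r ∈ Finset.range (⌊2 * √(D : ℝ)⌋₊ + 1),
      2 * ((r : ℤ) ^ 2 - D).natAbs.divisors.card ≤ 2 * ((4 * C + 1) * t ^ 4) := by
    intro r hr
    rw [Finset.mem_range, Nat.lt_succ_iff, Nat.le_floor_iff (by positivity)] at hr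
    have hr2 : r ^ 2 ≤ 4 * D := by
      have h1 : (r : ℝ) ^ 2 ≤ (2 * √D) ^ 2 := by gcongr
      rw [mul_pow, Real.sq_sqrt (Nat.cast_nonneg _)] at h1
      norm_num at h1
      exact_mod_cast h1
    set m := ((r : ℤ) ^ 2 - D).natAbs with hm
    have hm0 : m ≠ 0 := by
      rw [hm, Ne, Int.natAbs_eq_zero, sub_eq_zero]
      intro h
      exact hD ⟨r, by exact_mod_cast (by rw [← h]; ring : (D : ℤ) = r * r)⟩
    have hm4 : m ≤ 4 * D := by
      zify at hr2
      have : (0 : ℤ) ≤ (r : ℤ) ^ 2 := by positivity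
      omega
    refine Nat.mul_le_mul_left 2 (le_of_pow_le_pow_left₀ (n := 8) (by norm_num) (by positivity) ?_)
    calc m.divisors.card ^ 8 ≤ C * m := hC m hm0
      _ ≤ C * (4 * t ^ 30) := by gcongr; omega
      _ = 4 * C * t ^ 30 := by ring
      _ ≤ (4 * C + 1) ^ 8 * t ^ 32 := by
        gcongr
        · exact (Nat.le_succ _).trans (Nat.le_self_pow (by norm_num) _)
        · norm_num
      _ = ((4 * C + 1) * t ^ 4) ^ 8 := by ring
  refine (Finset.sum_le_card_nsmul _ _ _ hterm).trans ?_
  rw [Finset.card_range, smul_eq_mul]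
  calc _ ≤ (3 * t ^ 15) * (2 * ((4 * C + 1) * t ^ 4)) := by gcongr
    _ = _ := by ring

theorem exists_pell_pow {D : ℕ} {x y : ℤ} (h : x ^ 2 - D * y ^ 2 = 1) (hx : 0 < x) (hy : 0 < y)
    {k : ℕ} (hk : 1 ≤ k) : ∃ x' y' : ℤ, x' ^ 2 - D * y' ^ 2 = 1 ∧ 0 < x' ∧ 0 < y' ∧
      (x' + y' * √D : ℝ) = (x + y * √D) ^ k := by
  induction k, hk using Nat.le_induction with
  | base => exact ⟨x, y, h, hx, hy, by simp⟩
  | succ k hk ih =>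
    obtain ⟨x', y', h', hx', hy', heq⟩ := ih
    have hs : (√D : ℝ) ^ 2 = D := Real.sq_sqrt (Nat.cast_nonneg _)
    refine ⟨x' * x + D * y' * y, x' * y + y' * x, ?_, by positivity, by positivity, ?_⟩
    · calc (x' * x + D * y' * y) ^ 2 - D * (x' * y + y' * x) ^ 2
          = (x' ^ 2 - D * y' ^ 2) * (x ^ 2 - D * y ^ 2) := by ring
        _ = 1 := by rw [h, h', one_mul]
    · rw [pow_succ, ← heq]
      push_cast
      linear_combination (-(y' * y : ℝ)) * hs

/-- Normalised solutions of Pell's equation. -/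
theorem exists_pell_log_mem : ∃ t₀ : ℕ, ∀ t : ℕ, t₀ ≤ t → ∀ D : ℕ, ¬ IsSquare D → D ≤ t ^ 30 →
    ∃ x y : ℤ, x ^ 2 - D * y ^ 2 = 1 ∧ 0 < x ∧ 0 < y ∧
      (t : ℝ) ^ 21 / 2 ≤ log (x + y * √D) ∧ log (x + y * √D) ≤ (t : ℝ) ^ 21 := by
  obtain ⟨C, hC⟩ := exists_residueCount_le
  refine ⟨66 * (C + 2) + 1, fun t ht D hD hDt => ?_⟩
  have ht1 : 1 ≤ t := by omega
  have htR : (1 : ℝ) ≤ t := by exact_mod_cast ht1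
  have htC : (66 * (C + 2) : ℝ) ≤ t := by exact_mod_cast (by omega : 66 * (C + 2) ≤ t)
  obtain ⟨x, y, hxy, hx, hy, hlog⟩ := exists_pell_le hD
  have hD1 : 1 ≤ D := Nat.one_le_iff_ne_zero.mpr fun h => hD (h ▸ ⟨0, rfl⟩)
  have hDR : (1 : ℝ) ≤ √(D : ℝ) := Real.one_le_sqrt.mpr (by exact_mod_cast hD1)
  have hxR : (1 : ℝ) ≤ x := by exact_mod_cast hx
  have hyR : (1 : ℝ) ≤ y := by exact_mod_cast hy
  set ε : ℝ := x + y * √D with hε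
  have hε1 : 1 < ε := by
    have : 0 < (y : ℝ) * √D := by positivity
    linarith
  have hlogpos : 0 < log ε := log_pos hε1
  have hhalf : log ε ≤ (t : ℝ) ^ 21 / 2 := by
    have h1 : log (2 * D + 1) ≤ 33 * t := by
      have h2 : (2 * D + 1 : ℝ) ≤ 3 * (t : ℝ) ^ 30 := by
        have : (D : ℝ) ≤ (t : ℝ) ^ 30 := by exact_mod_cast hDt
        have := one_le_pow₀ htR (n := 30)
        linarith
      have h3 := log_le_sub_one_of_pos (by linarith : (0 : ℝ) < t)
      have h4 := log_le_sub_one_of_pos (by norm_num : (0 : ℝ) < 3)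
      calc log (2 * D + 1) ≤ log (3 * (t : ℝ) ^ 30) := log_le_log (by positivity) h2
        _ = log 3 + 30 * log t := by
          rw [log_mul (by norm_num) (by positivity), log_pow]; norm_num
        _ ≤ 33 * t := by linarith
    have h2 : (residueCount D + 2 : ℝ) ≤ (C + 2) * (t : ℝ) ^ 19 := by
      have : (residueCount D : ℝ) ≤ C * (t : ℝ) ^ 19 := by exact_mod_cast hC D t hD hDt
      have := one_le_pow₀ htR (n := 19)
      linarith
    calc log ε ≤ (residueCount D + 2) * log (2 * D + 1) := hlog
      _ ≤ ((C + 2) * (t : ℝ) ^ 19) * (33 * t) := by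
        gcongr
        exact log_nonneg (by have := Nat.cast_nonneg (α := ℝ) D; linarith)
      _ = (66 * (C + 2)) * (t : ℝ) ^ 20 / 2 := by ring
      _ ≤ t * (t : ℝ) ^ 20 / 2 := by gcongr
      _ = (t : ℝ) ^ 21 / 2 := by ring
  set k := ⌊(t : ℝ) ^ 21 / log ε⌋₊ with hk
  have hk1 : 1 ≤ k := by
    refine Nat.le_floor ?_
    rw [Nat.cast_one, one_le_div hlogpos]
    have : (0 : ℝ) ≤ (t : ℝ) ^ 21 := by positivity
    linarith
  obtain ⟨x', y', h', hx', hy', heq⟩ := exists_pell_pow hxy hx hy hk1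
  have hkle : k * log ε ≤ (t : ℝ) ^ 21 := by
    rw [← le_div_iff₀ hlogpos]
    exact Nat.floor_le (by positivity)
  have hklt : (t : ℝ) ^ 21 < (k + 1) * log ε := by
    rw [← div_lt_iff₀ hlogpos]
    exact Nat.lt_floor_add_one _
  refine ⟨x', y', h', hx', hy', ?_, ?_⟩ <;> rw [heq, log_pow] <;> linarith

/-- The order `ℤ[√D]`, embedded through its two real embeddings. -/
def quadraticOrder (D : ℕ) : Subring (Bool → ℝ) where
  carrier := {f | ∃ c d : ℤ, ∀ s, f s = c + d * (boolSign s * √D)}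
  zero_mem' := ⟨0, 0, by simp⟩
  one_mem' := ⟨1, 0, by simp⟩
  add_mem' := by
    rintro f g ⟨c, d, h⟩ ⟨c', d', h'⟩
    refine ⟨c + c', d + d', fun s => ?_⟩
    simp only [Pi.add_apply, h, h']; push_cast; ring
  neg_mem' := by
    rintro f ⟨c, d, h⟩
    refine ⟨-c, -d, fun s => ?_⟩
    simp only [Pi.neg_apply, h]; push_cast; ring
  mul_mem' := by
    rintro f g ⟨c, d, h⟩ ⟨c', d', h'⟩
    refine ⟨c * c' + D * d * d', c * d' + d * c', fun s => ?_⟩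
    have hs : (boolSign s * √D) ^ 2 = D := by
      rw [mul_pow, boolSign_sq, one_mul, Real.sq_sqrt (Nat.cast_nonneg _)]
    simp only [Pi.mul_apply, h, h']
    push_cast
    linear_combination (d * d' : ℝ) * hs

namespace quadraticOrder

variable {D D₁ D₂ : ℕ} {f : Bool → ℝ}

theorem comp_fst_mem (hf : f ∈ quadraticOrder D₁) :
    (fun σ : Bool × Bool => f σ.1) ∈ biquadraticOrder D₁ D₂ := by
  obtain ⟨c, d, h⟩ := hf
  exact ⟨c, d, 0, 0, fun σ => by simp [h]⟩

theorem comp_snd_mem (hf : f ∈ quadraticOrder D₂) :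
    (fun σ : Bool × Bool => f σ.2) ∈ biquadraticOrder D₁ D₂ := by
  obtain ⟨c, d, h⟩ := hf
  exact ⟨c, 0, d, 0, fun σ => by simp [h]⟩

theorem comp_not_mem (hf : f ∈ quadraticOrder D) : (fun s => f (!s)) ∈ quadraticOrder D := by
  obtain ⟨c, d, h⟩ := hf
  refine ⟨c, -d, ?_⟩
  rintro (_ | _) <;> simp [h, boolSign]

theorem sqrt_mem : (fun s => boolSign s * √D) ∈ quadraticOrder D := ⟨0, 1, by simp⟩

theorem intCast_mem (N : ℤ) : (fun _ => (N : ℝ)) ∈ quadraticOrder D := ⟨N, 0, by simp⟩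

/-- Totally positive units of norm one, raised to an integral power. -/
theorem exp_zsmul_mem {l : ℝ} (h : (fun s => exp (boolSign s * l)) ∈ quadraticOrder D) (k : ℤ) :
    (fun s => exp (boolSign s * (k * l))) ∈ quadraticOrder D := by
  have key : ∀ k : ℕ, (fun s => exp (boolSign s * (k * l))) ∈ quadraticOrder D := by
    intro k
    convert pow_mem h k using 1
    ext s
    rw [Pi.pow_apply, ← exp_nat_mul]
    ring_nf
  obtain ⟨k, rfl | rfl⟩ := k.eq_nat_or_neg
  · exact_mod_cast key k
  · convert comp_not_mem (key k) using 1
    ext s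
    cases s <;> simp [boolSign]

end quadraticOrder

theorem exists_simultaneous_division {t : ℕ} (ht : 100 ≤ t) {l₁ l₂ : ℝ}
    (hl₁ : (t : ℝ) ^ 21 / 2 ≤ l₁) (hl₁' : l₁ ≤ (t : ℝ) ^ 21)
    (hl₂ : (t : ℝ) ^ 21 / 2 ≤ l₂) (hl₂' : l₂ ≤ (t : ℝ) ^ 21) {m : ℕ}
    (hm : (t : ℝ) ^ 100 / 16 ≤ m * l₂) (hm' : m * l₂ ≤ (t : ℝ) ^ 100) :
    ∃ p₁ : ℤ, ∃ p₂ b r₂ : ℕ, 1 ≤ p₂ ∧ p₂ ≤ t ^ 26 ∧ m = b * p₂ + r₂ ∧ r₂ < p₂ ∧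
      |p₁ * l₁ - p₂ * l₂| ≤ 1 ∧ |p₁ * l₁ - p₂ * l₂| * (b * p₂) ≤ 2 * (t : ℝ) ^ 74 ∧
      (t : ℝ) ^ 79 / 32 ≤ b * p₂ ∧ (b * p₂ : ℝ) ≤ 2 * (t : ℝ) ^ 79 := by
  have htR : (100 : ℝ) ≤ t := by exact_mod_cast ht
  set T : ℝ := (t : ℝ) with hT
  have hT0 : 0 < T := by linarith
  have hl₁0 : 0 < l₁ := lt_of_lt_of_le (by positivity) hl₁
  have hl₂0 : 0 < l₂ := lt_of_lt_of_le (by positivity) hl₂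
  obtain ⟨p₁, k, hk0, hkP, hk⟩ := Real.exists_int_int_abs_mul_sub_le (l₂ / l₁)
    (n := t ^ 26) (by positivity)
  lift k to ℕ using hk0.le
  have hk1 : 1 ≤ k := by exact_mod_cast hk0
  have hkP' : k ≤ t ^ 26 := by exact_mod_cast hkP
  have hlin : |p₁ * l₁ - k * l₂| * T ^ 5 ≤ 1 := by
    have h1 : p₁ * l₁ - k * l₂ = -((((k : ℤ) : ℝ) * (l₂ / l₁) - p₁) * l₁) := by
      push_cast; field_simp; ring
    rw [h1, abs_neg, abs_mul, abs_of_pos hl₁0]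
    push_cast at hk ⊢
    have h2 : (1 : ℝ) / (T ^ 26 + 1) ≤ 1 / T ^ 26 := by gcongr; linarith
    calc _ ≤ (1 / T ^ 26) * T ^ 21 * T ^ 5 := by gcongr; exact hk.trans h2
      _ = 1 := by field_simp
  have hmle : (m : ℝ) ≤ 2 * T ^ 79 := by
    have : m * (T ^ 21 / 2) ≤ T ^ 100 := le_trans (by gcongr) hm'
    have h21 : 0 < T ^ 21 := by positivity
    refine le_of_mul_le_mul_right ?_ h21
    calc m * T ^ 21 = 2 * (m * (T ^ 21 / 2)) := by ring
      _ ≤ 2 * T ^ 100 := by gcongr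
      _ = _ := by ring
  have hmge : T ^ 79 / 16 ≤ (m : ℝ) := by
    have : T ^ 100 / 16 ≤ m * T ^ 21 := hm.trans (by gcongr)
    have h21 : 0 < T ^ 21 := by positivity
    refine le_of_mul_le_mul_right ?_ h21
    calc T ^ 79 / 16 * T ^ 21 = T ^ 100 / 16 := by ring
      _ ≤ _ := this
  have hdiv : m = m / k * k + m % k := by rw [mul_comm]; exact (Nat.div_add_mod m k).symm
  have hmod : m % k < k := Nat.mod_lt _ hk1
  have hbk : ((m / k : ℕ) * k : ℝ) ≤ 2 * T ^ 79 :=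
    le_trans (by exact_mod_cast Nat.div_mul_le_self m k) hmle
  have h5 : (1 : ℝ) ≤ T ^ 5 := one_le_pow₀ (by linarith)
  refine ⟨p₁, k, m / k, m % k, hk1, hkP', hdiv, hmod, ?_, ?_, ?_, hbk⟩
  · exact le_trans (le_mul_of_one_le_right (abs_nonneg _) h5) hlin
  · calc |p₁ * l₁ - k * l₂| * ((m / k : ℕ) * k) ≤ |p₁ * l₁ - k * l₂| * (2 * T ^ 79) := by gcongr
      _ = (|p₁ * l₁ - k * l₂| * T ^ 5) * (2 * T ^ 74) := by ring
      _ ≤ 1 * (2 * T ^ 74) := by gcongr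
      _ = _ := one_mul _
  · have h1 : (m : ℝ) = (m / k : ℕ) * k + (m % k : ℕ) := by exact_mod_cast hdiv
    have h2 : ((m % k : ℕ) : ℝ) ≤ T ^ 26 := by rw [hT]; exact_mod_cast hmod.le.trans hkP'
    have h3 : T ^ 26 * 32 ≤ T ^ 79 := by
      calc T ^ 26 * 32 ≤ T ^ 26 * T ^ 53 := by
            gcongr
            exact le_trans (by linarith) (le_self_pow₀ (by linarith) (by norm_num))
        _ = T ^ 79 := by ring
    linarith

theorem boolSign_mul_le_abs (s : Bool) (x : ℝ) : boolSign s * x ≤ |x| :=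
  (le_abs_self _).trans (by rw [abs_mul, abs_boolSign, one_mul])

set_option maxHeartbeats 2000000 in
theorem exp_neg_lt_abs_unit_linear_form {t : ℕ} (ht : 10 ^ 10 ≤ t) (htlog : 200000 * log t ≤ t)
    {D₁ D₂ : ℕ} (h₁ : ¬ IsSquare D₁) (h₂ : ¬ IsSquare D₂) (h₁₂ : ¬ IsSquare (D₁ * D₂))
    (hD₁ : D₁ ≤ t ^ 30) (hD₂ : D₂ ≤ t ^ 30) {l₁ l₂ : ℝ}
    (hl₁ : (t : ℝ) ^ 21 / 2 ≤ l₁) (hl₁' : l₁ ≤ (t : ℝ) ^ 21)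
    (hl₂ : (t : ℝ) ^ 21 / 2 ≤ l₂) (hl₂' : l₂ ≤ (t : ℝ) ^ 21)
    (he₁ : (fun s => exp (boolSign s * l₁)) ∈ quadraticOrder D₁)
    (he₂ : (fun s => exp (boolSign s * l₂)) ∈ quadraticOrder D₂)
    {γ₁ γ₂ : Bool → ℝ} (hγ₁ : γ₁ ∈ quadraticOrder D₁) (hγ₂ : γ₂ ∈ quadraticOrder D₂)
    (hγ₁1 : 1 ≤ γ₁ true) (hγ₂1 : 1 ≤ γ₂ true)
    (hγ₁t : γ₁ true ≤ exp ((t : ℝ) ^ 21)) (hγ₂t : γ₂ true ≤ exp ((t : ℝ) ^ 21))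
    (hγ₁f : |γ₁ false| ≤ exp ((t : ℝ) ^ 31)) (hγ₂f : |γ₂ false| ≤ exp ((t : ℝ) ^ 31))
    {N : ℤ} (hN0 : N ≠ 0) (hN : γ₁ true * γ₁ false = N) {m₁ m₂ : ℕ}
    (hm : (t : ℝ) ^ 100 / 16 ≤ m₂ * l₂) (hm' : m₂ * l₂ ≤ (t : ℝ) ^ 100) :
    exp (-(t : ℝ) ^ 99) <
      |m₁ * l₁ - m₂ * l₂ + log (γ₁ true) - log (γ₂ true) + log (√D₂) - log (√D₁)| := by
  set Λ := m₁ * l₁ - m₂ * l₂ + log (γ₁ true) - log (γ₂ true) + log (√D₂) - log (√D₁) with hΛ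
  by_contra! hcon
  obtain ⟨p₁, p₂, b, r₂, hp₂, hp₂t, hm₂, hr₂, hlin, hlinb, hbge, hble⟩ :=
    exists_simultaneous_division (le_trans (by norm_num) ht) hl₁ hl₁' hl₂ hl₂' hm hm'
  have htR : (10 : ℝ) ^ 10 ≤ t := by exact_mod_cast ht
  set T : ℝ := (t : ℝ) with hT
  have hT0 : 0 < T := by linarith
  have hT1 : 1 ≤ T := by linarith
  have hl₁0 : 0 < l₁ := lt_of_lt_of_le (by positivity) hl₁
  have hl₂0 : 0 < l₂ := lt_of_lt_of_le (by positivity) hl₂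
  have hlogT : 0 ≤ log T := log_nonneg hT1
  have hsqrt : ∀ D : ℕ, ¬ IsSquare D → D ≤ t ^ 30 → 0 < √(D : ℝ) ∧ 0 ≤ log (√D) ∧
      log (√D) ≤ T ∧ D ≤ exp T := by
    intro D hD hDt
    have hD1 : 1 ≤ D := Nat.one_le_iff_ne_zero.mpr fun h => hD (h ▸ ⟨0, rfl⟩)
    have hDR : (1 : ℝ) ≤ D := by exact_mod_cast hD1
    have hDT : (D : ℝ) ≤ T ^ 30 := by rw [hT]; exact_mod_cast hDt
    have hlog : log D ≤ T := by
      calc log D ≤ log (T ^ 30) := log_le_log (by linarith) hDT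
        _ = 30 * log T := by rw [log_pow]; norm_num
        _ ≤ T := by linarith
    have hlog0 := log_nonneg hDR
    refine ⟨by positivity, ?_, ?_, ?_⟩
    · rw [log_sqrt (by linarith)]; linarith
    · rw [log_sqrt (by linarith)]; linarith
    · rwa [← log_le_iff_le_exp (by linarith)]
  obtain ⟨hs₁, hls₁, hls₁', hDe₁⟩ := hsqrt D₁ h₁ hD₁
  obtain ⟨hs₂, hls₂, hls₂', hDe₂⟩ := hsqrt D₂ h₂ hD₂
  have hlγ₁ := log_nonneg hγ₁1
  have hlγ₂ := log_nonneg hγ₂1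
  have hlγ₁' : log (γ₁ true) ≤ T ^ 21 := (log_le_iff_le_exp (by linarith)).mpr hγ₁t
  have hlγ₂' : log (γ₂ true) ≤ T ^ 21 := (log_le_iff_le_exp (by linarith)).mpr hγ₂t
  have hT21 : 4 * T ≤ T ^ 21 := by
    calc 4 * T ≤ T ^ 20 * T := by
          gcongr; exact le_trans (by linarith) (le_self_pow₀ hT1 (by norm_num))
      _ = T ^ 21 := by ring
  have hT31 : 8 * T ^ 21 ≤ T ^ 31 := by
    calc 8 * T ^ 21 ≤ T ^ 10 * T ^ 21 := by
          gcongr; exact le_trans (by linarith) (le_self_pow₀ hT1 (by norm_num))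
      _ = T ^ 31 := by ring
  have hmm : |m₁ * l₁ - m₂ * l₂| ≤ 3 * T ^ 21 := by
    have h1 : |Λ| ≤ 1 := hcon.trans (exp_le_one_iff.mpr (by
      have : 0 < T ^ 99 := by positivity
      linarith))
    rw [abs_le] at h1 ⊢
    constructor <;> linarith
  set r₁ : ℤ := m₁ - b * p₁ with hr₁
  set lam := p₁ * l₁ - p₂ * l₂ with hlam
  set q := t ^ 74 / p₂ with hq
  have hp₂R : (1 : ℝ) ≤ p₂ := by exact_mod_cast hp₂
  have hp₂T : (p₂ : ℝ) ≤ T ^ 26 := by rw [hT]; exact_mod_cast hp₂t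
  have hqle : (q * p₂ : ℝ) ≤ T ^ 74 := by rw [hT]; exact_mod_cast Nat.div_mul_le_self _ _
  have hqlt : T ^ 74 ≤ (q + 1) * p₂ := by
    rw [hT]; exact_mod_cast (Nat.lt_mul_of_div_lt (Nat.lt_succ_self q) hp₂).le
  have hlb : |lam| * b ≤ 2 * (q + 1) := by
    refine le_of_mul_le_mul_right ?_ (by linarith : (0 : ℝ) < p₂)
    calc |lam| * b * p₂ = |lam| * (b * p₂) := by ring
      _ ≤ 2 * T ^ 74 := hlinb
      _ ≤ 2 * ((q + 1) * p₂) := by gcongr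
      _ = _ := by ring
  set A := 4 * p₂ * t ^ 21 with hA
  set G := 2 * p₂ * t ^ 21 + 2 * (q + 1) + 4 * t ^ 31 with hG
  have hAR : (A : ℝ) = 4 * p₂ * T ^ 21 := by rw [hA, hT]; push_cast; ring
  have hGR : (G : ℝ) = 2 * p₂ * T ^ 21 + 2 * (q + 1) + 4 * T ^ 31 := by
    rw [hG, hT]; push_cast; ring
  have hGp : G * p₂ ≤ 5 * T ^ 74 := by
    have e1 : (p₂ : ℝ) * p₂ * T ^ 21 ≤ T ^ 73 := by
      calc (p₂ : ℝ) * p₂ * T ^ 21 ≤ T ^ 26 * T ^ 26 * T ^ 21 := by gcongr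
        _ = T ^ 73 := by ring
    have e2 : T ^ 31 * p₂ ≤ T ^ 73 := by
      calc T ^ 31 * p₂ ≤ T ^ 31 * T ^ 26 := by gcongr
        _ = T ^ 57 := by ring
        _ ≤ T ^ 73 := pow_le_pow_right₀ hT1 (by norm_num)
    have e3 : (p₂ : ℝ) ≤ T ^ 73 := hp₂T.trans (pow_le_pow_right₀ hT1 (by norm_num))
    have e4 : 100 * T ^ 73 ≤ T ^ 74 := by
      rw [pow_succ' T 73]; gcongr; linarith
    rw [hGR]
    have : 0 < T ^ 73 := by positivity
    linarith
  have hsmall : (1000000 * A * G * t ^ 3 : ℕ) ≤ T ^ 99 := by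
    push_cast
    rw [hAR, ← hT]
    calc 1000000 * (4 * p₂ * T ^ 21) * G * T ^ 3 = 4000000 * T ^ 24 * (G * p₂) := by ring
      _ ≤ 4000000 * T ^ 24 * (5 * T ^ 74) := by gcongr
      _ = 20000000 * T ^ 98 := by ring
      _ ≤ T * T ^ 98 := by gcongr; linarith
      _ = T ^ 99 := by ring
  have hr₂R : (r₂ : ℝ) ≤ p₂ := by exact_mod_cast hr₂.le
  have hrl₂ : r₂ * l₂ ≤ p₂ * T ^ 21 := by gcongr
  have hrl₂0 : 0 ≤ r₂ * l₂ := by positivity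
  have hr₁l : |r₁ * l₁| ≤ 3 * T ^ 21 + p₂ * T ^ 21 + 2 * (q + 1) := by
    have e1 : r₁ * l₁ = (m₁ * l₁ - m₂ * l₂) + r₂ * l₂ - lam * b := by
      rw [hlam, hr₁, hm₂]; push_cast; ring
    have e2 : |lam * b| ≤ 2 * (q + 1) := by
      rwa [abs_mul, abs_of_nonneg (Nat.cast_nonneg b : (0 : ℝ) ≤ b)]
    rw [e1]
    rw [abs_le] at hmm e2 ⊢
    constructor <;> linarith
  set α : Bool × Bool → ℝ :=
    fun σ => exp (boolSign σ.1 * (p₁ * l₁)) * exp (boolSign σ.2 * (((-p₂ : ℤ) : ℝ) * l₂)) with hα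
  have hα_mem : α ∈ biquadraticOrder D₁ D₂ :=
    mul_mem (quadraticOrder.comp_fst_mem (quadraticOrder.exp_zsmul_mem he₁ p₁))
      (quadraticOrder.comp_snd_mem (quadraticOrder.exp_zsmul_mem he₂ (-p₂)))
  have hαt : α (true, true) = exp lam := by
    simp only [hα, boolSign, if_true, one_mul, ← exp_add, hlam]
    push_cast; ring_nf
  set ν : Bool × Bool → ℝ := fun σ => (N.sign : ℝ) * (exp (boolSign σ.1 * (((-r₁ : ℤ) : ℝ) * l₁)) *
    exp (boolSign σ.2 * (((r₂ : ℤ) : ℝ) * l₂))) * (γ₂ σ.2 * γ₁ (!σ.1)) *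
      ((boolSign σ.1 * √D₁) * (boolSign σ.2 * √D₂)) with hν
  have hν_mem : ν ∈ biquadraticOrder D₁ D₂ :=
    mul_mem (mul_mem (mul_mem (quadraticOrder.comp_fst_mem (quadraticOrder.intCast_mem N.sign))
      (mul_mem (quadraticOrder.comp_fst_mem (quadraticOrder.exp_zsmul_mem he₁ (-r₁)))
        (quadraticOrder.comp_snd_mem (quadraticOrder.exp_zsmul_mem he₂ r₂))))
      (mul_mem (quadraticOrder.comp_snd_mem hγ₂)
        (quadraticOrder.comp_fst_mem (quadraticOrder.comp_not_mem hγ₁))))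
      (mul_mem (quadraticOrder.comp_fst_mem quadraticOrder.sqrt_mem)
        (quadraticOrder.comp_snd_mem quadraticOrder.sqrt_mem))
  have hD₂1 : 1 ≤ D₂ := Nat.one_le_iff_ne_zero.mpr fun h => h₂ (h ▸ ⟨0, rfl⟩)
  have hN1 : 1 ≤ N.natAbs := Int.natAbs_pos.mpr hN0
  have hdelta : 1 ≤ N.natAbs * D₂ := Nat.mul_pos hN1 hD₂1
  have hNabs : (N.natAbs : ℝ) = |(N : ℝ)| := by rw [Nat.cast_natAbs, Int.cast_abs]
  have hq0 : (0 : ℝ) ≤ q := Nat.cast_nonneg q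
  have hT21p : T ^ 21 ≤ p₂ * T ^ 21 := le_mul_of_one_le_left (by positivity) hp₂R
  have hdeltaG : ((N.natAbs * D₂ : ℕ) : ℝ) ≤ exp G := by
    push_cast
    rw [hNabs, ← hN, abs_mul, abs_of_pos (by linarith)]
    calc γ₁ true * |γ₁ false| * D₂ ≤ exp (T ^ 21) * exp (T ^ 31) * exp T := by gcongr
      _ = exp (T ^ 21 + T ^ 31 + T) := by rw [exp_add, exp_add]
      _ ≤ exp G := by
        rw [hGR]
        exact exp_le_exp.mpr (by linarith)
  have hαA : ∀ σ, |α σ| ≤ exp A := by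
    intro σ
    have e0 := boolSign_mul_le_abs σ.1 (p₁ * l₁)
    have e1 := boolSign_mul_le_abs σ.2 (((-p₂ : ℤ) : ℝ) * l₂)
    have e2 : |((-p₂ : ℤ) : ℝ) * l₂| = p₂ * l₂ := by
      push_cast
      rw [neg_mul, abs_neg, abs_of_nonneg (by positivity)]
    have e3 : |p₁ * l₁| ≤ 1 + p₂ * l₂ := by
      have : p₁ * l₁ = lam + p₂ * l₂ := by rw [hlam]; ring
      rw [this]
      refine (abs_add_le _ _).trans (add_le_add hlin ?_)
      rw [abs_of_nonneg (by positivity)]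
    have e4 : p₂ * l₂ ≤ p₂ * T ^ 21 := by gcongr
    rw [hα]
    simp only
    rw [← exp_add, abs_exp, exp_le_exp, hAR]
    linarith
  have hγle : ∀ γ : Bool → ℝ, 1 ≤ γ true → γ true ≤ exp (T ^ 21) → |γ false| ≤ exp (T ^ 31) →
      ∀ s, |γ s| ≤ exp (T ^ 31) := by
    rintro γ h1 h2 h3 (_ | _)
    · exact h3
    · rw [abs_of_pos (by linarith)]
      exact h2.trans (exp_le_exp.mpr (by linarith))
  have hsle : ∀ D : ℕ, 0 < √(D : ℝ) → log (√D) ≤ T → ∀ s, |boolSign s * √D| ≤ exp T := by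
    intro D h1 h2 s
    rw [abs_mul, abs_boolSign, one_mul, abs_of_pos h1]
    exact (log_le_iff_le_exp h1).mp h2
  have hνG : ∀ σ, |ν σ| ≤ exp G := by
    intro σ
    have e0 := boolSign_mul_le_abs σ.1 (((-r₁ : ℤ) : ℝ) * l₁)
    have e1 := boolSign_mul_le_abs σ.2 (((r₂ : ℤ) : ℝ) * l₂)
    have e2 : |((-r₁ : ℤ) : ℝ) * l₁| = |r₁ * l₁| := by push_cast; rw [neg_mul, abs_neg]
    have e3 : |((r₂ : ℤ) : ℝ) * l₂| = r₂ * l₂ := by push_cast; exact abs_of_nonneg hrl₂0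
    have e4 : |(N.sign : ℝ)| ≤ 1 := by
      rcases Int.sign_trichotomy N with h | h | h <;> rw [h] <;> norm_num
    rw [hν]
    simp only
    rw [← exp_add, abs_mul, abs_mul, abs_mul, abs_mul (γ₂ _), abs_mul (boolSign _ * _), abs_exp]
    calc _ ≤ (1 * exp (|r₁ * l₁| + r₂ * l₂)) * (exp (T ^ 31) * exp (T ^ 31)) *
          (exp T * exp T) := by
          refine mul_le_mul (mul_le_mul (mul_le_mul e4 (exp_le_exp.mpr (by linarith)) ?_ ?_)
            (mul_le_mul (hγle γ₂ hγ₂1 hγ₂t hγ₂f _) (hγle γ₁ hγ₁1 hγ₁t hγ₁f _) ?_ ?_) ?_ ?_)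
            (mul_le_mul (hsle D₁ hs₁ hls₁' _) (hsle D₂ hs₂ hls₂' _) ?_ ?_) ?_ ?_ <;> positivity
      _ = exp ((|r₁ * l₁| + r₂ * l₂) + (T ^ 31 + T ^ 31) + (T + T)) := by
        rw [one_mul, ← exp_add, ← exp_add, ← exp_add, ← exp_add]
      _ ≤ exp G := by
        rw [hGR]
        exact exp_le_exp.mpr (by linarith)
  have hα1 : α (true, true) ≠ 1 := by
    intro h
    have h0 : α - 1 = 0 := biquadraticOrder.eq_zero_of_apply_eq_zero h₁ h₂ h₁₂
      (sub_mem hα_mem (one_mem _)) (σ := (true, true)) (by simp [h])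
    have h1 : α (false, true) = 1 := by
      have := congrFun h0 (false, true)
      simpa [sub_eq_zero] using this
    rw [hαt, exp_eq_one_iff, hlam] at h
    simp only [hα, boolSign, if_true, one_mul, ← exp_add, exp_eq_one_iff] at h1
    push_cast at h1
    have h2 : 0 < p₂ * l₂ := by positivity
    norm_num at h1
    linarith
  have hνdiv : ν (true, true) / (N.natAbs * D₂ : ℕ) =
      exp (-(r₁ * l₁)) * exp (r₂ * l₂) * (γ₂ true / γ₁ true) * (√D₁ / √D₂) := by
    have e1 : (N.natAbs : ℝ) = N.sign * (γ₁ true * γ₁ false) := by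
      rw [hN, ← Int.cast_mul, Int.sign_mul_self_eq_natAbs, Int.cast_natCast]
    have e2 : (√D₂ : ℝ) ^ 2 = D₂ := Real.sq_sqrt (Nat.cast_nonneg _)
    have e8 : (D₂ : ℝ) ≠ 0 := by positivity
    have e3 : (N.natAbs : ℝ) ≠ 0 := by positivity
    have e4 : (N.sign : ℝ) ≠ 0 := fun h => e3 (by rw [e1, h, zero_mul])
    have e5 : γ₁ false ≠ 0 := fun h => e3 (by rw [e1, h, mul_zero, mul_zero])
    have e6 : γ₁ true ≠ 0 := by positivity
    have e7 : √(D₂ : ℝ) ≠ 0 := hs₂.ne'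
    simp only [hν, boolSign, if_true, one_mul, Bool.not_true]
    rw [Nat.cast_mul, e1]
    push_cast
    rw [neg_mul]
    field_simp
    linear_combination e2
  have hν0 : 0 < ν (true, true) := by
    have : 0 < ν (true, true) / (N.natAbs * D₂ : ℕ) := by rw [hνdiv]; positivity
    exact (div_pos_iff_of_pos_right (by exact_mod_cast hdelta)).mp this
  have hb : 4000 * G * t ≤ b := by
    have e0 : (4000 * G * T) * p₂ ≤ b * p₂ := by
      calc (4000 * G * T) * p₂ = 4000 * T * (G * p₂) := by ring
        _ ≤ 4000 * T * (5 * T ^ 74) := by gcongr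
        _ = 640000 * T ^ 75 / 32 := by ring
        _ ≤ T ^ 4 * T ^ 75 / 32 := by
          gcongr; exact le_trans (by linarith) (le_self_pow₀ hT1 (by norm_num))
        _ = T ^ 79 / 32 := by ring
        _ ≤ b * p₂ := hbge
    have e1 : 4000 * G * T ≤ b := le_of_mul_le_mul_right e0 (by linarith)
    rw [hT] at e1
    exact_mod_cast e1
  have hlogb : 1000 * log (b * (4000 * A * t) : ℕ) ≤ t := by
    have e0 : ((b * (4000 * A * t) : ℕ) : ℝ) ≤ T ^ 102 := by
      push_cast
      rw [hAR, ← hT]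
      calc b * (4000 * (4 * p₂ * T ^ 21) * T) = 16000 * (b * p₂) * T ^ 22 := by ring
        _ ≤ 16000 * (2 * T ^ 79) * T ^ 22 := by gcongr
        _ = 32000 * T ^ 101 := by ring
        _ ≤ T * T ^ 101 := by gcongr; linarith
        _ = T ^ 102 := by ring
    have e1 : 1 ≤ b * (4000 * A * t) := by
      have h1 : 0 < p₂ := hp₂
      have h2 : 0 < b := lt_of_lt_of_le (by positivity) hb
      have h3 : 0 < t := by omega
      exact Nat.succ_le_of_lt (by positivity)
    have e2 : log (b * (4000 * A * t) : ℕ) ≤ 102 * log T := by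
      calc _ ≤ log (T ^ 102) := log_le_log (by exact_mod_cast e1) e0
        _ = _ := by rw [log_pow]; norm_num
    linarith
  have hA1 : 1 ≤ A := by
    have h1 : 0 < p₂ := hp₂
    have h3 : 0 < t := by omega
    exact Nat.succ_le_of_lt (by positivity)
  have hG1 : 1 ≤ G := Nat.succ_le_of_lt (by positivity)
  have key := exp_lt_abs_linear_form h₁ h₂ h₁₂ hα_mem hν_mem (A := A) (G := G) (t := t)
    (δ := N.natAbs * D₂) (b := b) hA1 hG1 (le_trans (by norm_num) ht)
    hdelta hdeltaG hαA hνG (by rw [hαt]; positivity) hα1 hν0 hb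
    (by rw [hαt, log_exp, hGR]; nlinarith [pow_pos hT0 21, pow_pos hT0 31]) hlogb
  rw [hνdiv, hαt, log_exp, log_mul (by positivity) (by positivity),
    log_mul (by positivity) (by positivity), log_mul (by positivity) (by positivity), log_exp,
    log_exp, log_div (by positivity) (by positivity), log_div (by positivity) (by positivity)]
    at key
  have hΛeq : b * lam - (-(r₁ * l₁) + r₂ * l₂ + (log (γ₂ true) - log (γ₁ true)) +
      (log (√D₁) - log (√D₂))) = Λ := by
    rw [hΛ, hlam, hr₁, hm₂]
    push_cast
    ring
  rw [hΛeq] at key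
  exact absurd (key.trans_le hcon) (not_lt.mpr (exp_le_exp.mpr (by linarith)))

theorem quadraticOrder.exp_log_mem {D : ℕ} {x y : ℤ} (h : x ^ 2 - D * y ^ 2 = 1)
    (hx : 0 < x) (hy : 0 < y) :
    (fun s => exp (boolSign s * log (x + y * √D))) ∈ quadraticOrder D := by
  have hs : (√D : ℝ) ^ 2 = D := Real.sq_sqrt (Nat.cast_nonneg _)
  have hxR : (0 : ℝ) < x := by exact_mod_cast hx
  have hyR : (0 : ℝ) < y := by exact_mod_cast hy
  have hpos : 0 < (x + y * √D : ℝ) := by positivity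
  have hR : (x : ℝ) ^ 2 - D * (y : ℝ) ^ 2 = 1 := by exact_mod_cast h
  refine ⟨x, y, ?_⟩
  rintro (_ | _)
  · simp only [boolSign, Bool.false_eq_true, if_false, neg_mul, one_mul, exp_neg, exp_log hpos]
    refine inv_eq_of_mul_eq_one_right ?_
    linear_combination hR - (y : ℝ) ^ 2 * hs
  · simp [boolSign, exp_log hpos]

/-- Reduction of an element of a real quadratic order by powers of a unit. -/
theorem quadraticOrder.exists_unit_reduction {D : ℕ} {l : ℝ} (hl : 0 < l)
    (he : (fun s => exp (boolSign s * l)) ∈ quadraticOrder D) {β : Bool → ℝ}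
    (hβ : β ∈ quadraticOrder D) (hβ1 : 1 ≤ β true) :
    ∃ m : ℕ, ∃ γ ∈ quadraticOrder D, 1 ≤ γ true ∧ γ true ≤ exp l ∧
      γ true * γ false = β true * β false ∧ m * l + log (γ true) = log (β true) := by
  have hpos : 0 < β true := by linarith
  have hlog := log_nonneg hβ1
  set m := ⌊log (β true) / l⌋₊ with hm
  have h1 : m * l ≤ log (β true) := by
    rw [← le_div_iff₀ hl]
    exact Nat.floor_le (by positivity)
  have h2 : log (β true) < (m + 1) * l := by
    rw [← div_lt_iff₀ hl]
    exact Nat.lt_floor_add_one _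
  have ht : β true * exp (boolSign true * (((-m : ℤ) : ℝ) * l)) = exp (log (β true) - m * l) := by
    rw [sub_eq_add_neg, exp_add, exp_log hpos]
    simp [boolSign]
  refine ⟨m, _, mul_mem hβ (exp_zsmul_mem he (-m)), ?_, ?_, ?_, ?_⟩
  · simp only [Pi.mul_apply, ht]
    exact one_le_exp (by linarith)
  · simp only [Pi.mul_apply, ht]
    exact exp_le_exp.mpr (by linarith)
  · simp only [Pi.mul_apply]
    rw [mul_mul_mul_comm, ← exp_add]
    simp [boolSign]
  · simp only [Pi.mul_apply, ht, log_exp]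
    ring

theorem abs_log_sub_log_le {u v : ℝ} (hu : 1 ≤ u) (hv : 1 ≤ v) : |log u - log v| ≤ |u - v| := by
  have key : ∀ u v : ℝ, 1 ≤ u → 1 ≤ v → v ≤ u → log u - log v ≤ u - v := by
    intro u v hu hv huv
    rw [← log_div (by positivity) (by positivity)]
    calc log (u / v) ≤ u / v - 1 := log_le_sub_one_of_pos (by positivity)
      _ = (u - v) / v := by field_simp
      _ ≤ u - v := div_le_self (by linarith) hv
  rcases le_total v u with h | h
  · rw [abs_of_nonneg (sub_nonneg.mpr (log_le_log (by linarith) h)),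
      abs_of_nonneg (sub_nonneg.mpr h)]
    exact key u v hu hv h
  · rw [abs_sub_comm, abs_sub_comm u,
      abs_of_nonneg (sub_nonneg.mpr (log_le_log (by linarith) h)),
      abs_of_nonneg (sub_nonneg.mpr h)]
    exact key v u hv hu h

theorem Nat.isSquare_of_isSquare_mul_sq {m k : ℕ} (hk : k ≠ 0) (h : IsSquare (m * k ^ 2)) :
    IsSquare m := by
  obtain ⟨r, hr⟩ := h
  have hkr : k ∣ r := (Nat.pow_dvd_pow_iff two_ne_zero).mp ⟨m, by linarith⟩
  obtain ⟨c, rfl⟩ := hkr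
  exact ⟨c, Nat.eq_of_mul_eq_mul_right (pow_pos (Nat.pos_of_ne_zero hk) 2) (by linarith)⟩

/-- If `x ^ 2 + j ^ 2 = 2 * a * j + B ^ 2`, then `(a - j, x)` lies on the circle through
`(a, B)` centred at the origin. -/
theorem circle_point_bounds {t a B j x : ℕ} (ht : 10 ^ 10 ≤ t)
    (ha : (t : ℝ) ^ 100 / 4 ≤ log a) (ha' : log a ≤ (t : ℝ) ^ 100)
    (hB : (B : ℝ) ≤ exp ((t : ℝ) ^ 29)) (hj : 1 ≤ j) (hj' : j ≤ t ^ 15)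
    (hx : x ^ 2 + j ^ 2 = 2 * a * j + B ^ 2) :
    exp ((t : ℝ) ^ 100 / 8) ≤ x ∧ (x : ℝ) ≤ exp (3 / 4 * (t : ℝ) ^ 100) := by
  have htR : (10 : ℝ) ^ 10 ≤ t := by exact_mod_cast ht
  have hjT : (j : ℝ) ≤ (t : ℝ) ^ 15 := by exact_mod_cast hj'
  set T : ℝ := (t : ℝ) with hT
  have hT0 : 0 < T := by linarith
  have hT1 : 1 ≤ T := by linarith
  have h29 : 100 * T ^ 29 ≤ T ^ 100 := by
    calc 100 * T ^ 29 ≤ T ^ 71 * T ^ 29 := by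
          gcongr; exact le_trans (by linarith) (le_self_pow₀ hT1 (by norm_num))
      _ = T ^ 100 := by ring
  have h15 : T ^ 15 ≤ T ^ 29 := pow_le_pow_right₀ hT1 (by norm_num)
  have h29' : 10 ≤ T ^ 29 := le_trans (by linarith) (le_self_pow₀ hT1 (by norm_num))
  have hlog : 0 < log a := by linarith
  have ha0 : (0 : ℝ) < a := by
    rcases Nat.eq_zero_or_pos a with rfl | h
    · simp at hlog
    · exact_mod_cast h
  have hae : exp (T ^ 100 / 4) ≤ a := (le_log_iff_exp_le ha0).mp ha
  have hae' : a ≤ exp (T ^ 100) := (log_le_iff_le_exp ha0).mp ha'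
  have hjR : (1 : ℝ) ≤ j := by exact_mod_cast hj
  have hja : (j : ℝ) ≤ a := by
    have := add_one_le_exp (T ^ 100 / 4)
    linarith
  have hxR : (x : ℝ) ^ 2 + (j : ℝ) ^ 2 = 2 * a * j + (B : ℝ) ^ 2 := by exact_mod_cast hx
  constructor
  · refine le_of_sq_le_sq ?_ (Nat.cast_nonneg _)
    rw [← exp_nat_mul]
    calc exp ((2 : ℕ) * (T ^ 100 / 8)) = exp (T ^ 100 / 4) := by congr 1; push_cast; ring
      _ ≤ a * 1 := by linarith
      _ ≤ a * j := by gcongr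
      _ ≤ x ^ 2 := by nlinarith
  · refine le_of_sq_le_sq ?_ (exp_pos _).le
    have hjexp : (j : ℝ) ≤ exp (T ^ 29) := by
      have := add_one_le_exp (T ^ 29)
      linarith
    rw [← exp_nat_mul]
    have hB2 : (B : ℝ) ^ 2 ≤ exp (T ^ 100 + 2 * T ^ 29) := by
      calc (B : ℝ) ^ 2 ≤ exp (T ^ 29) ^ 2 := by gcongr
        _ = exp (2 * T ^ 29) := by rw [← exp_nat_mul]; norm_num
        _ ≤ _ := exp_le_exp.mpr (by linarith)
    have haj : a * j ≤ exp (T ^ 100 + 2 * T ^ 29) := by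
      calc (a * j : ℝ) ≤ exp (T ^ 100) * exp (T ^ 29) := by gcongr
        _ = exp (T ^ 100 + T ^ 29) := by rw [exp_add]
        _ ≤ _ := exp_le_exp.mpr (by linarith)
    have h3 : (3 : ℝ) ≤ exp (T ^ 29) := by
      have := add_one_le_exp (T ^ 29)
      linarith
    calc (x : ℝ) ^ 2 ≤ 3 * exp (T ^ 100 + 2 * T ^ 29) := by
          linarith [sq_nonneg (j : ℝ)]
      _ ≤ exp (T ^ 29) * exp (T ^ 100 + 2 * T ^ 29) := by gcongr
      _ = exp (T ^ 29 + (T ^ 100 + 2 * T ^ 29)) := (exp_add _ _).symm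
      _ ≤ _ := exp_le_exp.mpr (by push_cast; linarith)

theorem exists_int_circle_pair {t a B j k x y : ℕ} (ht : 10 ^ 10 ≤ t)
    (hB : (B : ℝ) ≤ exp ((t : ℝ) ^ 29)) (hj : 1 ≤ j) (hj' : j ≤ t ^ 15)
    (hk : 1 ≤ k) (hk' : k ≤ t ^ 15) (hjk : j ≠ k)
    (hx : x ^ 2 + j ^ 2 = 2 * a * j + B ^ 2) (hy : y ^ 2 + k ^ 2 = 2 * a * k + B ^ 2) :
    ∃ N : ℤ, N ≠ 0 ∧ (k : ℤ) * x ^ 2 - j * y ^ 2 = N ∧ |(N : ℝ)| ≤ exp (4 * (t : ℝ) ^ 29) := by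
  have hjT : (j : ℝ) ≤ (t : ℝ) ^ 15 := by exact_mod_cast hj'
  have hkT : (k : ℝ) ≤ (t : ℝ) ^ 15 := by exact_mod_cast hk'
  have htR : (10 : ℝ) ^ 10 ≤ t := by exact_mod_cast ht
  set T : ℝ := (t : ℝ) with hT
  have hT1 : 1 ≤ T := by linarith
  have h15 : T ^ 15 ≤ T ^ 29 := pow_le_pow_right₀ hT1 (by norm_num)
  have h29 : 10 ≤ T ^ 29 := le_trans (by linarith) (le_self_pow₀ hT1 (by norm_num))
  have he := add_one_le_exp (T ^ 29)
  refine ⟨(k - j) * (B ^ 2 + j * k), ?_, ?_, ?_⟩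
  · refine mul_ne_zero (sub_ne_zero.mpr (by exact_mod_cast hjk.symm)) ?_
    positivity
  · have hx' : (x : ℤ) ^ 2 + j ^ 2 = 2 * a * j + B ^ 2 := by exact_mod_cast hx
    have hy' : (y : ℤ) ^ 2 + k ^ 2 = 2 * a * k + B ^ 2 := by exact_mod_cast hy
    linear_combination k * hx' - j * hy'
  · push_cast
    have hj0 : (0 : ℝ) ≤ j := Nat.cast_nonneg _
    have hk0 : (0 : ℝ) ≤ k := Nat.cast_nonneg _
    rw [abs_mul, abs_of_nonneg (by positivity : (0 : ℝ) ≤ (B : ℝ) ^ 2 + j * k)]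
    have h1 : |(k : ℝ) - j| ≤ exp (T ^ 29) := by
      rw [abs_le]; constructor <;> linarith
    have hjk' : (j : ℝ) * k ≤ exp (T ^ 29) * exp (T ^ 29) := by gcongr <;> linarith
    calc |(k : ℝ) - j| * ((B : ℝ) ^ 2 + j * k)
        ≤ exp (T ^ 29) * (exp (T ^ 29) ^ 2 + exp (T ^ 29) * exp (T ^ 29)) := by gcongr
      _ = 2 * exp (T ^ 29) ^ 3 := by ring
      _ ≤ exp (T ^ 29) * exp (T ^ 29) ^ 3 := by gcongr; linarith
      _ = exp (T ^ 29) ^ 4 := by ring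
      _ = _ := by rw [← exp_nat_mul]; norm_num

theorem not_isSquare_circle_pair {t a B j k x y : ℕ} (ht : 10 ^ 10 ≤ t)
    (ha : (t : ℝ) ^ 100 / 4 ≤ log a) (ha' : log a ≤ (t : ℝ) ^ 100)
    (hB : (B : ℝ) ≤ exp ((t : ℝ) ^ 29)) (hj : 1 ≤ j) (hj' : j ≤ t ^ 15)
    (hk : 1 ≤ k) (hk' : k ≤ t ^ 15) (hjk : j ≠ k)
    (hx : x ^ 2 + j ^ 2 = 2 * a * j + B ^ 2) (hy : y ^ 2 + k ^ 2 = 2 * a * k + B ^ 2) :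
    ¬ IsSquare (j * k) := by
  rintro ⟨s, hs⟩
  obtain ⟨N, hN0, hN, hNle⟩ := exists_int_circle_pair ht hB hj hj' hk hk' hjk hx hy
  obtain ⟨hxe, -⟩ := circle_point_bounds ht ha ha' hB hj hj' hx
  have hs' : (j : ℤ) * k = s * s := by exact_mod_cast hs
  have hfac : ((k : ℤ) * x - s * y) * (k * x + s * y) = k * N := by
    rw [← hN]
    linear_combination (y : ℤ) ^ 2 * hs'
  have hkN : (k : ℤ) * N ≠ 0 := mul_ne_zero (by positivity) hN0
  have hle : (k : ℤ) * x + s * y ≤ k * |N| := by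
    have h1 : (k : ℤ) * x + s * y ∣ k * N := ⟨_, by rw [← hfac, mul_comm]⟩
    have h2 := Int.le_of_dvd (abs_pos.mpr hkN) ((dvd_abs _ _).mpr h1)
    rwa [abs_mul, Nat.abs_cast] at h2
  have hxN : (x : ℤ) ≤ |N| := by
    refine le_of_mul_le_mul_left ?_ (by positivity : (0 : ℤ) < k)
    have : (0 : ℤ) ≤ s * y := by positivity
    linarith
  have hxNR : (x : ℝ) ≤ |(N : ℝ)| := by exact_mod_cast hxN
  have htR : (10 : ℝ) ^ 10 ≤ t := by exact_mod_cast ht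
  set T : ℝ := (t : ℝ) with hT
  have hT1 : 1 ≤ T := by linarith
  have h29 : 100 * T ^ 29 ≤ T ^ 100 := by
    calc 100 * T ^ 29 ≤ T ^ 71 * T ^ 29 := by
          gcongr; exact le_trans (by linarith) (le_self_pow₀ hT1 (by norm_num))
      _ = T ^ 100 := by ring
  have h0 : 0 < T ^ 29 := by positivity
  have := exp_le_exp.mp ((hxe.trans hxNR).trans hNle)
  linarith

/-- The element of `ℤ[√(j k)]` attached to a pair of points, and its reduction by a unit. -/
theorem exists_circle_pair_reduction {t a B j k x y : ℕ} (ht : 10 ^ 10 ≤ t)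
    (hpell : ∀ D : ℕ, ¬ IsSquare D → D ≤ t ^ 30 → ∃ x y : ℤ,
      x ^ 2 - D * y ^ 2 = 1 ∧ 0 < x ∧ 0 < y ∧
      (t : ℝ) ^ 21 / 2 ≤ log (x + y * √D) ∧ log (x + y * √D) ≤ (t : ℝ) ^ 21)
    (ha : (t : ℝ) ^ 100 / 4 ≤ log a) (ha' : log a ≤ (t : ℝ) ^ 100)
    (hB : (B : ℝ) ≤ exp ((t : ℝ) ^ 29)) (hj : 1 ≤ j) (hj' : j ≤ t ^ 15)
    (hk : 1 ≤ k) (hk' : k ≤ t ^ 15) (hjk : j ≠ k)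
    (hx : x ^ 2 + j ^ 2 = 2 * a * j + B ^ 2) (hy : y ^ 2 + k ^ 2 = 2 * a * k + B ^ 2) :
    1 ≤ x * k + y * √(j * k : ℕ) ∧
    ∃ l : ℝ, (t : ℝ) ^ 21 / 2 ≤ l ∧ l ≤ (t : ℝ) ^ 21 ∧
      (fun s => exp (boolSign s * l)) ∈ quadraticOrder (j * k) ∧
      ∃ γ ∈ quadraticOrder (j * k), 1 ≤ γ true ∧ γ true ≤ exp ((t : ℝ) ^ 21) ∧
        |γ false| ≤ exp ((t : ℝ) ^ 31) ∧ (∃ N : ℤ, N ≠ 0 ∧ γ true * γ false = N) ∧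
        ∃ m : ℕ, (t : ℝ) ^ 100 / 16 ≤ m * l ∧ m * l ≤ (t : ℝ) ^ 100 ∧
          m * l + log (γ true) = log (x * k + y * √(j * k : ℕ)) := by
  obtain ⟨hxe, hxe'⟩ := circle_point_bounds ht ha ha' hB hj hj' hx
  obtain ⟨-, hye'⟩ := circle_point_bounds ht ha ha' hB hk hk' hy
  obtain ⟨N, hN0, hN, hNle⟩ := exists_int_circle_pair ht hB hj hj' hk hk' hjk hx hy
  have hD := not_isSquare_circle_pair ht ha ha' hB hj hj' hk hk' hjk hx hy
  have hDt : j * k ≤ t ^ 30 := (Nat.mul_le_mul hj' hk').trans_eq (by ring)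
  have hjR : (1 : ℝ) ≤ j := by exact_mod_cast hj
  have hkR : (1 : ℝ) ≤ k := by exact_mod_cast hk
  have hjT : (j : ℝ) ≤ (t : ℝ) ^ 15 := by exact_mod_cast hj'
  have hkT : (k : ℝ) ≤ (t : ℝ) ^ 15 := by exact_mod_cast hk'
  have htR : (10 : ℝ) ^ 10 ≤ t := by exact_mod_cast ht
  set T : ℝ := (t : ℝ) with hT
  have hT1 : 1 ≤ T := by linarith
  have h29 : 10 ≤ T ^ 29 := le_trans (by linarith) (le_self_pow₀ hT1 (by norm_num))
  have h15 : T ^ 15 ≤ T ^ 29 := pow_le_pow_right₀ hT1 (by norm_num)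
  have h31 : 100 * T ^ 29 ≤ T ^ 31 := by
    calc 100 * T ^ 29 ≤ T ^ 2 * T ^ 29 := by
          gcongr; exact le_trans (by linarith) (le_self_pow₀ hT1 (by norm_num))
      _ = T ^ 31 := by ring
  have h100 : 100 * T ^ 31 ≤ T ^ 100 := by
    calc 100 * T ^ 31 ≤ T ^ 69 * T ^ 31 := by
          gcongr; exact le_trans (by linarith) (le_self_pow₀ hT1 (by norm_num))
      _ = T ^ 100 := by ring
  have h21 : T ^ 21 ≤ T ^ 29 := pow_le_pow_right₀ hT1 (by norm_num)
  have hT21 : 0 < T ^ 21 := by positivity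
  have he := add_one_le_exp (T ^ 29)
  have hsq : √(j * k : ℕ) ≤ exp (T ^ 29) := by
    rw [Real.sqrt_le_left (exp_pos _).le]
    push_cast
    rw [sq]
    gcongr <;> linarith
  have hs2 : √(j * k : ℕ) ^ 2 = (j * k : ℕ) := Real.sq_sqrt (Nat.cast_nonneg _)
  set β : Bool → ℝ := fun s => (x * k : ℤ) + (y : ℤ) * (boolSign s * √(j * k : ℕ)) with hβ
  have hβt : β true = x * k + y * √(j * k : ℕ) := by simp [hβ, boolSign]
  have hβge : exp (T ^ 100 / 8) ≤ β true := by
    rw [hβt]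
    calc exp (T ^ 100 / 8) ≤ x * 1 := by linarith
      _ ≤ x * k := by gcongr
      _ ≤ _ := by linarith [mul_nonneg (Nat.cast_nonneg (α := ℝ) y) (Real.sqrt_nonneg (j * k : ℕ))]
  have hβle : β true ≤ exp (T ^ 100) := by
    rw [hβt]
    calc _ ≤ exp (3 / 4 * T ^ 100) * exp (T ^ 29) + exp (3 / 4 * T ^ 100) * exp (T ^ 29) := by
          gcongr; linarith
      _ = 2 * exp (3 / 4 * T ^ 100 + T ^ 29) := by rw [exp_add]; ring
      _ ≤ exp (T ^ 29) * exp (3 / 4 * T ^ 100 + T ^ 29) := by gcongr; linarith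
      _ = exp (T ^ 29 + (3 / 4 * T ^ 100 + T ^ 29)) := (exp_add _ _).symm
      _ ≤ _ := exp_le_exp.mpr (by linarith)
  have hβ1 : 1 ≤ β true := (one_le_exp (by positivity)).trans hβge
  refine ⟨hβt ▸ hβ1, ?_⟩
  obtain ⟨u, v, huv, hu, hv, hl, hl'⟩ := hpell _ hD hDt
  set l := log (u + v * √(j * k : ℕ)) with hldef
  have hl0 : 0 < l := by linarith
  have hmem := quadraticOrder.exp_log_mem huv hu hv
  obtain ⟨m, γ, hγ, hγ1, hγl, hγN, hγm⟩ :=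
    quadraticOrder.exists_unit_reduction hl0 hmem (β := β) ⟨x * k, y, fun _ => rfl⟩ hβ1
  have hnorm : γ true * γ false = (k * N : ℤ) := by
    rw [hγN]
    have hNR : (k : ℝ) * x ^ 2 - j * y ^ 2 = N := by exact_mod_cast hN
    simp only [hβ, boolSign, Bool.false_eq_true, if_true, if_false]
    push_cast at hs2 ⊢
    linear_combination k * hNR - (y : ℝ) ^ 2 * hs2
  have hγf : |γ false| ≤ exp (T ^ 31) := by
    calc |γ false| ≤ |γ true| * |γ false| :=
          le_mul_of_one_le_left (abs_nonneg _) (hγ1.trans (le_abs_self _))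
      _ = k * |(N : ℝ)| := by
        rw [← abs_mul, hnorm]; push_cast; rw [abs_mul, Nat.abs_cast]
      _ ≤ exp (T ^ 29) * exp (4 * T ^ 29) := by gcongr; linarith
      _ = exp (T ^ 29 + 4 * T ^ 29) := (exp_add _ _).symm
      _ ≤ _ := exp_le_exp.mpr (by linarith)
  have hlogγ := log_nonneg hγ1
  have hlogγ' : log (γ true) ≤ l := (log_le_iff_le_exp (by linarith)).mpr hγl
  have hlogβ : T ^ 100 / 8 ≤ log (β true) := (le_log_iff_exp_le (by linarith)).mpr hβge
  have hlogβ' : log (β true) ≤ T ^ 100 := (log_le_iff_le_exp (by linarith)).mpr hβle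
  refine ⟨l, hl, hl', hmem, γ, hγ, hγ1, hγl.trans (exp_le_exp.mpr hl'), hγf,
    ⟨k * N, mul_ne_zero (by positivity) hN0, hnorm⟩, m, ?_, ?_, ?_⟩
  · linarith
  · linarith
  · rw [hγm, hβt]

theorem exists_no_three_circle_points : ∃ t₀ : ℕ, ∀ t : ℕ, t₀ ≤ t → ∀ a B : ℕ,
    (t : ℝ) ^ 100 / 4 ≤ log a → log a ≤ (t : ℝ) ^ 100 → (B : ℝ) ≤ exp ((t : ℝ) ^ 29) →
    ∀ j x : Fin 3 → ℕ, Function.Injective j → (∀ i, 1 ≤ j i ∧ j i ≤ t ^ 15) →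
      ¬ ∀ i, x i ^ 2 + j i ^ 2 = 2 * a * j i + B ^ 2 := by
  obtain ⟨t₁, ht₁⟩ := exists_pell_log_mem
  have hlittle : ∀ᶠ y : ℝ in Filter.atTop, 200000 * log y ≤ y := by
    have := isLittleO_log_id_atTop.def (show (0 : ℝ) < 1 / 200000 by norm_num)
    filter_upwards [this, Filter.eventually_ge_atTop 1] with y hy hy1
    rw [norm_of_nonneg (log_nonneg hy1), id, norm_of_nonneg (by linarith)] at hy
    linarith
  obtain ⟨t₂, ht₂⟩ := Filter.eventually_atTop.mp
    (tendsto_natCast_atTop_atTop.eventually hlittle)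
  refine ⟨max (10 ^ 10) (max t₁ t₂), fun t ht a B ha ha' hB j x hinj hj hx => ?_⟩
  simp only [max_le_iff] at ht
  obtain ⟨ht0, ht1, ht2⟩ := ht
  have hne : ∀ i k : Fin 3, i ≠ k → j i ≠ j k := fun i k h => hinj.ne h
  have hpell := ht₁ t ht1
  obtain ⟨hu, l₁, hl₁, hl₁', he₁, γ₁, hγ₁, hγ₁1, hγ₁t, hγ₁f, ⟨N, hN0, hN⟩, m₁, -, -, hm₁⟩ :=
    exists_circle_pair_reduction ht0 hpell ha ha' hB (hj 0).1 (hj 0).2 (hj 2).1 (hj 2).2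
      (hne 0 2 (by decide)) (hx 0) (hx 2)
  obtain ⟨hv, l₂, hl₂, hl₂', he₂, γ₂, hγ₂, hγ₂1, hγ₂t, hγ₂f, -, m₂, hm₂l, hm₂u, hm₂⟩ :=
    exists_circle_pair_reduction ht0 hpell ha ha' hB (hj 1).1 (hj 1).2 (hj 2).1 (hj 2).2
      (hne 1 2 (by decide)) (hx 1) (hx 2)
  have h₁ := not_isSquare_circle_pair ht0 ha ha' hB (hj 0).1 (hj 0).2 (hj 2).1 (hj 2).2
    (hne 0 2 (by decide)) (hx 0) (hx 2)
  have h₂ := not_isSquare_circle_pair ht0 ha ha' hB (hj 1).1 (hj 1).2 (hj 2).1 (hj 2).2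
    (hne 1 2 (by decide)) (hx 1) (hx 2)
  have h₃ := not_isSquare_circle_pair ht0 ha ha' hB (hj 0).1 (hj 0).2 (hj 1).1 (hj 1).2
    (hne 0 1 (by decide)) (hx 0) (hx 1)
  have h₁₂ : ¬ IsSquare (j 0 * j 2 * (j 1 * j 2)) := fun h =>
    h₃ (Nat.isSquare_of_isSquare_mul_sq (k := j 2) (by have := (hj 2).1; omega)
      (by convert h using 1; ring))
  have key := exp_neg_lt_abs_unit_linear_form ht0 (ht₂ t ht2) h₁ h₂ h₁₂
    ((Nat.mul_le_mul (hj 0).2 (hj 2).2).trans_eq (by ring))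
    ((Nat.mul_le_mul (hj 1).2 (hj 2).2).trans_eq (by ring)) hl₁ hl₁' hl₂ hl₂' he₁ he₂ hγ₁ hγ₂
    hγ₁1 hγ₂1 hγ₁t hγ₂t hγ₁f hγ₂f hN0 hN hm₂l hm₂u (m₁ := m₁)
  obtain ⟨M, -, hM, hMle⟩ := exists_int_circle_pair ht0 hB (hj 0).1 (hj 0).2 (hj 1).1 (hj 1).2
    (hne 0 1 (by decide)) (hx 0) (hx 1)
  obtain ⟨hxe, -⟩ := circle_point_bounds ht0 ha ha' hB (hj 0).1 (hj 0).2 (hx 0)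
  have hs : ∀ i, 1 ≤ √(j i * j 2 : ℕ) := fun i =>
    Real.one_le_sqrt.mpr (by exact_mod_cast Nat.mul_pos (hj i).1 (hj 2).1)
  have hs2 : ∀ i, √(j i * j 2 : ℕ) ^ 2 = j i * j 2 := fun i => by
    rw [Real.sq_sqrt (Nat.cast_nonneg _)]; push_cast; rfl
  have hj2 : (j 2 : ℝ) ≤ (t : ℝ) ^ 15 := by exact_mod_cast (hj 2).2
  have hMR : (j 1 : ℝ) * x 0 ^ 2 - j 0 * x 1 ^ 2 = M := by exact_mod_cast hM
  have htR : (10 : ℝ) ^ 10 ≤ t := by exact_mod_cast ht0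
  have hs0 := hs 0
  have hs1 := hs 1
  have hs20 := hs2 0
  have hs21 := hs2 1
  generalize √(j 0 * j 2 : ℕ) = r₁ at *
  generalize √(j 1 * j 2 : ℕ) = r₂ at *
  set T : ℝ := (t : ℝ) with hT
  have hT1 : 1 ≤ T := by linarith
  set u := x 0 * j 2 + x 2 * r₁ with hudef
  set v := x 1 * j 2 + x 2 * r₂ with hvdef
  have hlogs : m₁ * l₁ - m₂ * l₂ + log (γ₁ true) - log (γ₂ true) + log r₂ - log r₁ =
      log (u * r₂) - log (v * r₁) := by
    rw [log_mul (by positivity) (by positivity), log_mul (by positivity) (by positivity),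
      ← hm₁, ← hm₂]
    ring
  rw [hlogs] at key
  have hle := key.trans_le (abs_log_sub_log_le (one_le_mul_of_one_le_of_one_le hu hs1)
    (one_le_mul_of_one_le_of_one_le hv hs0))
  have hprod : (u * r₂ - v * r₁) * (x 0 * r₂ + x 1 * r₁) = j 2 ^ 2 * M := by
    rw [← hMR, hudef, hvdef]
    linear_combination (j 2 * x 0 ^ 2 : ℝ) * hs21 - (j 2 * x 1 ^ 2 : ℝ) * hs20
  have h15 : T ^ 15 ≤ T ^ 29 := pow_le_pow_right₀ hT1 (by norm_num)
  have h29 : T ^ 29 ≤ T ^ 99 := pow_le_pow_right₀ hT1 (by norm_num)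
  have h99 : 100 * T ^ 99 ≤ T ^ 100 := by
    rw [pow_succ' T 99]; gcongr; linarith
  have he := add_one_le_exp (T ^ 29)
  have h99p : 0 < T ^ 99 := by positivity
  have hfinal : exp (-T ^ 99) * exp (T ^ 100 / 8) < exp (6 * T ^ 29) := by
    calc exp (-T ^ 99) * exp (T ^ 100 / 8)
        < |u * r₂ - v * r₁| * exp (T ^ 100 / 8) := by gcongr
      _ ≤ |u * r₂ - v * r₁| * |x 0 * r₂ + x 1 * r₁| := by
        gcongr
        refine le_trans ?_ (le_abs_self _)
        calc exp (T ^ 100 / 8) ≤ x 0 * 1 := by linarith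
          _ ≤ x 0 * r₂ := by gcongr
          _ ≤ x 0 * r₂ + x 1 * r₁ := le_add_of_nonneg_right (by positivity)
      _ = j 2 ^ 2 * |(M : ℝ)| := by
        rw [← abs_mul, hprod, abs_mul, abs_of_nonneg (by positivity)]
      _ ≤ exp (T ^ 29) ^ 2 * exp (4 * T ^ 29) := by gcongr; linarith
      _ = exp (6 * T ^ 29) := by rw [← exp_nat_mul, ← exp_add]; push_cast; ring_nf
  rw [← exp_add, exp_lt_exp] at hfinal
  linarith

theorem exists_nat_pow_hundred_approx (t₀ : ℕ) : ∃ n₀ : ℕ, ∀ n : ℕ, n₀ ≤ n → ∃ t : ℕ,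
    t₀ ≤ t ∧ (t : ℝ) ^ 100 ≤ log n ∧ log n ≤ 2 * (t : ℝ) ^ 100 := by
  have htend : Filter.Tendsto (fun n : ℕ => log n ^ ((1 : ℝ) / 100)) Filter.atTop Filter.atTop :=
    (tendsto_rpow_atTop (by norm_num)).comp (tendsto_log_atTop.comp tendsto_natCast_atTop_atTop)
  obtain ⟨n₀, hn₀⟩ := Filter.eventually_atTop.mp
    (htend.eventually_ge_atTop ((max t₀ 1000 : ℕ) : ℝ))
  refine ⟨n₀, fun n hn => ?_⟩
  have hlog : 0 ≤ log n := log_natCast_nonneg n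
  have hy := hn₀ n hn
  have hy100 : (log n ^ ((1 : ℝ) / 100)) ^ 100 = log n := by
    rw [← rpow_natCast, ← rpow_mul hlog]; norm_num
  set y := log n ^ ((1 : ℝ) / 100) with hydef
  have hy0 : 0 ≤ y := by positivity
  have hfl : max t₀ 1000 ≤ ⌊y⌋₊ := Nat.le_floor hy
  have hT : (1000 : ℝ) ≤ ⌊y⌋₊ := by exact_mod_cast (le_max_right _ _).trans hfl
  have h1 := Nat.floor_le hy0
  have h2 := Nat.lt_floor_add_one y
  refine ⟨⌊y⌋₊, (le_max_left _ _).trans hfl, ?_, ?_⟩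
  · rw [← hy100]; gcongr
  · rw [← hy100]
    set T : ℝ := (⌊y⌋₊ : ℝ)
    calc y ^ 100 ≤ (T * (1001 / 1000)) ^ 100 := by gcongr; linarith
      _ = (1001 / 1000) ^ 100 * T ^ 100 := by rw [mul_pow, mul_comm]
      _ ≤ 2 * T ^ 100 := by gcongr; norm_num

theorem rpow_two_sevenths_le {T L : ℝ} (hT : 4 ≤ T) (hL0 : 0 ≤ L) (hL : L ≤ 2 * T ^ 100) :
    L ^ ((2 : ℝ) / 7) ≤ T ^ 29 := by
  refine le_of_pow_le_pow_left₀ (n := 7) (by norm_num) (by positivity) ?_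
  have h1 : (L ^ ((2 : ℝ) / 7)) ^ 7 = L ^ 2 := by
    rw [← rpow_natCast, ← rpow_mul hL0, ← rpow_natCast]; norm_num
  rw [h1]
  calc L ^ 2 ≤ (2 * T ^ 100) ^ 2 := by gcongr
    _ = 4 * T ^ 200 := by ring
    _ ≤ T ^ 3 * T ^ 200 := by
      gcongr; exact hT.trans (le_self_pow₀ (by linarith) (by norm_num))
    _ = (T ^ 29) ^ 7 := by ring

theorem two_mul_rpow_seventh_le {T L : ℝ} (hT : 256 ≤ T) (hL0 : 0 ≤ L) (hL : L ≤ 2 * T ^ 100) :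
    2 * L ^ ((1 : ℝ) / 7) ≤ T ^ 15 := by
  refine le_of_pow_le_pow_left₀ (n := 7) (by norm_num) (by positivity) ?_
  have h1 : (L ^ ((1 : ℝ) / 7)) ^ 7 = L := by
    rw [← rpow_natCast, ← rpow_mul hL0]; norm_num
  rw [mul_pow, h1]
  calc 2 ^ 7 * L ≤ 2 ^ 7 * (2 * T ^ 100) := by gcongr
    _ = 256 * T ^ 100 := by ring
    _ ≤ T ^ 5 * T ^ 100 := by
      gcongr; exact hT.trans (le_self_pow₀ (by linarith) (by norm_num))
    _ = (T ^ 15) ^ 7 := by ring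

/-- A lattice point of small ordinate on a circle through `(a, B)`. -/
theorem natAbs_add_of_small_ordinate {n a B : ℕ} (hn : n = a ^ 2 + B ^ 2) (hBa : B ^ 2 ≤ a)
    {w : ℝ} (hw : 0 ≤ w) {c x : ℤ} (hcx : c ^ 2 + x ^ 2 = n) (hx : (x : ℝ) ^ 2 ≤ √n * w) :
    ∃ j : ℕ, c.natAbs + j = a ∧ (j : ℝ) ≤ 2 * w ∧ x.natAbs ^ 2 + j ^ 2 = 2 * a * j + B ^ 2 := by
  have hcn : (c.natAbs : ℤ) ^ 2 = c ^ 2 := Int.natAbs_sq c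
  have hxn : (x.natAbs : ℤ) ^ 2 = x ^ 2 := Int.natAbs_sq x
  have hnat : c.natAbs ^ 2 + x.natAbs ^ 2 = a ^ 2 + B ^ 2 := by
    zify
    rw [← Int.natAbs_sq, ← Int.natAbs_sq x] at hcx
    push_cast [hn] at hcx
    simpa using hcx
  have hca : c.natAbs ≤ a := by
    by_contra! h
    have : (a + 1) ^ 2 ≤ c.natAbs ^ 2 := Nat.pow_le_pow_left h 2
    nlinarith
  obtain ⟨j, hj⟩ := Nat.exists_eq_add_of_le hca
  have hxj : x.natAbs ^ 2 + j ^ 2 = 2 * a * j + B ^ 2 := by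
    rw [hj] at hnat ⊢
    nlinarith
  refine ⟨j, hj.symm, ?_, hxj⟩
  rcases Nat.eq_zero_or_pos a with ha | ha
  · have : j = 0 := by omega
    simp [this, hw]
  have haR : (0 : ℝ) < a := by exact_mod_cast ha
  have hja : (j : ℝ) ≤ a := by exact_mod_cast (by omega : j ≤ a)
  have hsqrt : √(n : ℝ) ≤ 2 * a := by
    rw [Real.sqrt_le_left (by positivity), hn]
    have h1 : ((B ^ 2 : ℕ) : ℝ) ≤ a := by exact_mod_cast hBa
    have h2 : (1 : ℝ) ≤ a := by exact_mod_cast ha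
    push_cast at h1 ⊢
    nlinarith
  have hxR : (x : ℝ) ^ 2 + (j : ℝ) ^ 2 = 2 * a * j + (B : ℝ) ^ 2 := by
    have : x ^ 2 + (j : ℤ) ^ 2 = 2 * a * j + B ^ 2 := by rw [← hxn]; exact_mod_cast hxj
    exact_mod_cast this
  refine le_of_mul_le_mul_left ?_ haR
  calc (a : ℝ) * j ≤ 2 * a * j - j ^ 2 := by nlinarith [Nat.cast_nonneg (α := ℝ) j]
    _ ≤ (x : ℝ) ^ 2 := by nlinarith [sq_nonneg (B : ℝ)]
    _ ≤ √n * w := hx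
    _ ≤ 2 * a * w := by gcongr
    _ = a * (2 * w) := by ring

/-- Points of the circle of radius `√n` lying over the abscissae `±(a - j)`, `j ∈ s`. -/
theorem ncard_circle_points_le {n a : ℤ} {S : Set (ℤ × ℤ)} (s : Finset ℕ)
    (hS : ∀ p ∈ S, p.1 ^ 2 + p.2 ^ 2 = n ∧ ∃ j ∈ s, (p.1.natAbs : ℤ) + j = a) :
    S.ncard ≤ s.card * 4 := by
  classical
  set F : ℕ → Finset (ℤ × ℤ) := fun j =>
    {(a - j, Int.sqrt (n - (a - j) ^ 2)), (a - j, -Int.sqrt (n - (a - j) ^ 2)),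
      (-(a - j), Int.sqrt (n - (a - j) ^ 2)), (-(a - j), -Int.sqrt (n - (a - j) ^ 2))} with hF
  have hsub : S ⊆ (s.biUnion F : Finset (ℤ × ℤ)) := by
    rintro ⟨c, x⟩ hp
    obtain ⟨hcx, j, hj, hcj⟩ := hS _ hp
    simp only at hcx hcj
    have hc : (c.natAbs : ℤ) = a - j := by linarith
    have hx : Int.sqrt (n - (a - j) ^ 2) = x.natAbs := by
      rw [← Int.sqrt_eq x, ← hc, Int.natAbs_sq]
      congr 1
      linarith
    simp only [Finset.coe_biUnion, Set.mem_iUnion, Finset.mem_coe]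
    refine ⟨j, hj, ?_⟩
    simp only [hF, hx, Finset.mem_insert, Finset.mem_singleton, Prod.mk.injEq]
    omega
  calc S.ncard ≤ ((s.biUnion F : Finset (ℤ × ℤ)) : Set (ℤ × ℤ)).ncard :=
        Set.ncard_le_ncard hsub (Finset.finite_toSet _)
    _ = (s.biUnion F).card := Set.ncard_coe_finset _
    _ ≤ s.card * 4 := Finset.card_biUnion_le_card_mul _ _ _ fun j _ => Finset.card_le_four

/-- For sufficiently large `n`, if `n = a₁ ^ 2 + b₁ ^ 2` with `|b₁| ≤ exp((log n)^(2/7))`,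
then the circle `a ^ 2 + b ^ 2 = n` has at most thirty six lattice points with
`|b| < n^(1/4) (log n)^(1/14)`. -/
theorem circle_lattice_points_near_axis :
    ∃ n₀ : ℕ, ∀ n : ℕ, n₀ ≤ n →
      (∃ a₁ b₁ : ℤ, (n : ℤ) = a₁ ^ 2 + b₁ ^ 2 ∧
        (|b₁| : ℝ) ≤ Real.exp ((Real.log n) ^ ((2 : ℝ) / 7))) →
      {p : ℤ × ℤ | p.1 ^ 2 + p.2 ^ 2 = (n : ℤ) ∧
        (|p.2| : ℝ) < (n : ℝ) ^ ((1 : ℝ) / 4) * (Real.log n) ^ ((1 : ℝ) / 14)}.ncard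
        ≤ 36 := by
  classical
  obtain ⟨t₀, ht₀⟩ := exists_no_three_circle_points
  obtain ⟨n₀, hn₀⟩ := exists_nat_pow_hundred_approx (max t₀ 1000)
  refine ⟨n₀, fun n hn => ?_⟩
  rintro ⟨a₁, b₁, hab, hb⟩
  obtain ⟨t, ht, htlog, hlogt⟩ := hn₀ n hn
  have hlog0 : 0 ≤ log n := log_natCast_nonneg n
  have htR : (1000 : ℝ) ≤ t := by exact_mod_cast (le_max_right _ _).trans ht
  have hno := ht₀ t ((le_max_left _ _).trans ht)
  have hB : ((b₁.natAbs : ℕ) : ℝ) ≤ exp ((t : ℝ) ^ 29) := by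
    rw [Nat.cast_natAbs, Int.cast_abs]
    exact hb.trans (exp_le_exp.mpr (rpow_two_sevenths_le (by linarith) hlog0 hlogt))
  have hw := two_mul_rpow_seventh_le (by linarith) hlog0 hlogt
  have hsum : n = a₁.natAbs ^ 2 + b₁.natAbs ^ 2 := by
    zify
    rw [hab, sq_abs, sq_abs]
  generalize a₁.natAbs = a at *
  generalize b₁.natAbs = B at *
  set w := log n ^ ((1 : ℝ) / 7) with hwdef
  have hw0 : 0 ≤ w := by positivity
  have hT1 : (1 : ℝ) ≤ t := by linarith
  have h100 : 1000 * (t : ℝ) ^ 29 ≤ (t : ℝ) ^ 100 := by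
    calc 1000 * (t : ℝ) ^ 29 ≤ (t : ℝ) ^ 71 * (t : ℝ) ^ 29 := by
          gcongr; exact htR.trans (le_self_pow₀ hT1 (by norm_num))
      _ = (t : ℝ) ^ 100 := by ring
  have h29 : 1 ≤ (t : ℝ) ^ 29 := one_le_pow₀ hT1
  have hn0 : (0 : ℝ) < n := by
    rcases Nat.eq_zero_or_pos n with rfl | h
    · simp only [Nat.cast_zero, log_zero] at htlog
      linarith
    · exact_mod_cast h
  have hsumR : (n : ℝ) = (a : ℝ) ^ 2 + (B : ℝ) ^ 2 := by exact_mod_cast hsum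
  have hB2 : (B : ℝ) ^ 2 ≤ exp (2 * (t : ℝ) ^ 29) := by
    calc (B : ℝ) ^ 2 ≤ exp ((t : ℝ) ^ 29) ^ 2 := by gcongr
      _ = _ := by rw [← exp_nat_mul]; norm_num
  have hne : exp ((t : ℝ) ^ 100) ≤ n := (le_log_iff_exp_le hn0).mp htlog
  have h2n : 2 * exp ((t : ℝ) ^ 100 / 2) ≤ n := by
    have h1 := add_one_le_exp ((t : ℝ) ^ 100 / 2)
    calc 2 * exp ((t : ℝ) ^ 100 / 2) ≤ exp ((t : ℝ) ^ 100 / 2) * exp ((t : ℝ) ^ 100 / 2) := by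
          gcongr; linarith
      _ = exp ((t : ℝ) ^ 100) := by rw [← exp_add]; ring_nf
      _ ≤ n := hne
  have hBexp : (B : ℝ) ^ 2 ≤ exp ((t : ℝ) ^ 100 / 4) :=
    hB2.trans (exp_le_exp.mpr (by linarith))
  have hae : exp ((t : ℝ) ^ 100 / 4) ≤ a := by
    refine le_of_sq_le_sq ?_ (Nat.cast_nonneg _)
    have h1 : exp ((t : ℝ) ^ 100 / 4) ≤ exp ((t : ℝ) ^ 100 / 2) := exp_le_exp.mpr (by linarith)
    rw [← exp_nat_mul, show ((2 : ℕ) : ℝ) * ((t : ℝ) ^ 100 / 4) = (t : ℝ) ^ 100 / 2 by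
      push_cast; ring]
    linarith
  have ha0 : (0 : ℝ) < a := (exp_pos _).trans_le hae
  have ha : (t : ℝ) ^ 100 / 4 ≤ log a := (le_log_iff_exp_le ha0).mpr hae
  have ha' : log a ≤ (t : ℝ) ^ 100 := by
    have h1 : 2 * log a ≤ log n := by
      calc 2 * log a = log ((a : ℝ) ^ 2) := by rw [log_pow]; norm_num
        _ ≤ log n := log_le_log (by positivity) (by rw [hsumR]; linarith [sq_nonneg (B : ℝ)])
    linarith
  have hBa : B ^ 2 ≤ a := by exact_mod_cast hBexp.trans hae
  set J := (Finset.Icc 1 (t ^ 15)).filter fun j => ∃ x : ℕ, x ^ 2 + j ^ 2 = 2 * a * j + B ^ 2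
    with hJ
  have hJcard : J.card ≤ 2 := by
    by_contra! h
    obtain ⟨s, hsJ, hs⟩ := Finset.exists_subset_card_eq (Nat.succ_le_of_lt h)
    have hmem : ∀ i, s.orderEmbOfFin hs i ∈ J := fun i => hsJ (s.orderEmbOfFin_mem hs i)
    simp only [hJ, Finset.mem_filter, Finset.mem_Icc] at hmem
    choose hj x hx using hmem
    exact hno a B ha ha' hB _ x (s.orderEmbOfFin hs).injective hj hx
  refine (ncard_circle_points_le (n := n) (a := a) (insert 0 J) ?_).trans
    ((Nat.mul_le_mul_right 4 ((Finset.card_insert_le _ _).trans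
      (Nat.succ_le_succ hJcard))).trans (by norm_num))
  rintro ⟨c, x⟩ ⟨hcx, hx⟩
  simp only at hcx hx
  refine ⟨hcx, ?_⟩
  have hx2 : (x : ℝ) ^ 2 ≤ √n * w := by
    calc (x : ℝ) ^ 2 = |(x : ℝ)| ^ 2 := (sq_abs _).symm
      _ ≤ ((n : ℝ) ^ ((1 : ℝ) / 4) * log n ^ ((1 : ℝ) / 14)) ^ 2 := by gcongr
      _ = √n * w := by
        rw [mul_pow, ← rpow_natCast, ← rpow_natCast, ← rpow_mul hn0.le, ← rpow_mul hlog0,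
          sqrt_eq_rpow, hwdef]
        norm_num
  obtain ⟨j, hj, hjw, hxj⟩ := natAbs_add_of_small_ordinate hsum hBa hw0 hcx hx2
  refine ⟨j, ?_, by exact_mod_cast hj⟩
  rcases Nat.eq_zero_or_pos j with rfl | hj0
  · exact Finset.mem_insert_self _ _
  · refine Finset.mem_insert_of_mem (Finset.mem_filter.mpr ⟨Finset.mem_Icc.mpr ⟨hj0, ?_⟩, _, hxj⟩)
    exact_mod_cast hjw.trans hw
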